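/- arXiv:2311.15885 — 2 statements merged into one kernel-verified Lean document; each statement's English description precedes it below -/
import Mathlib

section
/- For every integer k ≥ 4 there exist a real ε > 0 and a natural number n₀ such that for every n > n₀ there are a finite relational signature σ, all of whose relation symbols have arity at most k, and two σ-structures 𝒜, ℬ with |A| = |B| = n, such that some sentence of ∃⁺L^k distinguishes 𝒜 from ℬ, yet 𝒜 and ℬ agree on every sentence φ of ∃⁺L^k with quant(φ) < 2^{ε·n^{2k−4}}. -/
namespace QVT

/-- A finite relational signature: a finite type of relation symbols, each with an arity. -/
structure Signature : Type 1 where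
  symbols : Type
  fin : Fintype symbols
  arity : symbols → ℕ

/-- A structure over a relational signature. -/
structure Struct (σ : Signature) : Type 1 where
  carrier : Type
  rel : (R : σ.symbols) → (Fin (σ.arity R) → carrier) → Prop

/-- First-order formulas over the signature `σ`, with variables indexed by `ℕ`
(variable `i` represents `x_{i+1}`; variables may be reused and requantified). -/
inductive Fml (σ : Signature) : Type
  | eq : ℕ → ℕ → Fml σ
  | rel : (R : σ.symbols) → (Fin (σ.arity R) → ℕ) → Fml σ
  | not : Fml σ → Fml σ
  | and : Fml σ → Fml σ → Fml σ
  | or : Fml σ → Fml σ → Fml σ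
  | ex : ℕ → Fml σ → Fml σ
  | all : ℕ → Fml σ → Fml σ

namespace Fml

variable {σ : Signature}

/-- Satisfaction of a formula in a structure under a (total) variable assignment. -/
def Sat (M : Struct σ) : (ℕ → M.carrier) → Fml σ → Prop
  | f, .eq i j => f i = f j
  | f, .rel R v => M.rel R fun m => f (v m)
  | f, .not φ => ¬ Sat M f φ
  | f, .and φ ψ => Sat M f φ ∧ Sat M f ψ
  | f, .or φ ψ => Sat M f φ ∨ Sat M f ψ
  | f, .ex i φ => ∃ a : M.carrier, Sat M (Function.update f i a) φ
  | f, .all i φ => ∀ a : M.carrier, Sat M (Function.update f i a) φ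

/-- All variables (free or bound) occurring in a formula. -/
def vars : Fml σ → Finset ℕ
  | .eq i j => {i, j}
  | .rel _ v => Finset.univ.image v
  | .not φ => vars φ
  | .and φ ψ => vars φ ∪ vars ψ
  | .or φ ψ => vars φ ∪ vars ψ
  | .ex i φ => insert i (vars φ)
  | .all i φ => insert i (vars φ)

/-- The free variables of a formula. -/
def freeVars : Fml σ → Finset ℕ
  | .eq i j => {i, j}
  | .rel _ v => Finset.univ.image v
  | .not φ => freeVars φ
  | .and φ ψ => freeVars φ ∪ freeVars ψ
  | .or φ ψ => freeVars φ ∪ freeVars ψ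
  | .ex i φ => (freeVars φ).erase i
  | .all i φ => (freeVars φ).erase i

/-- The number of quantifier occurrences in a formula. -/
def quant : Fml σ → ℕ
  | .eq _ _ => 0
  | .rel _ _ => 0
  | .not φ => quant φ
  | .and φ ψ => quant φ + quant ψ
  | .or φ ψ => quant φ + quant ψ
  | .ex _ φ => quant φ + 1
  | .all _ φ => quant φ + 1

/-- The quantifier depth (quantifier rank) of a formula. -/
def depth : Fml σ → ℕ
  | .eq _ _ => 0
  | .rel _ _ => 0
  | .not φ => depth φ
  | .and φ ψ => max (depth φ) (depth ψ)
  | .or φ ψ => max (depth φ) (depth ψ)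
  | .ex _ φ => depth φ + 1
  | .all _ φ => depth φ + 1

/-- The size (total number of symbols) of a formula. -/
def size : Fml σ → ℕ
  | .eq _ _ => 3
  | .rel R _ => 1 + σ.arity R
  | .not φ => size φ + 1
  | .and φ ψ => size φ + size ψ + 1
  | .or φ ψ => size φ + size ψ + 1
  | .ex _ φ => size φ + 2
  | .all _ φ => size φ + 2

/-- The existential-positive formulas: built from atomic formulas using only
`∧`, `∨` and `∃`. -/
def ExPos : Fml σ → Prop
  | .eq _ _ => True
  | .rel _ _ => True
  | .not _ => False
  | .and φ ψ => ExPos φ ∧ ExPos ψ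
  | .or φ ψ => ExPos φ ∧ ExPos ψ
  | .ex _ φ => ExPos φ
  | .all _ _ => False

end Fml

/-- `φ` is a formula of `L^k`: it only uses the variables `x_1, …, x_k`
(indices `0, …, k-1`). -/
def UsesVars {σ : Signature} (k : ℕ) (φ : Fml σ) : Prop :=
  ∀ i ∈ φ.vars, i < k

/-- A sentence is a formula with no free variables. -/
def IsSentence {σ : Signature} (φ : Fml σ) : Prop := φ.freeVars = ∅

/-- Satisfaction of a sentence (assignment-independent for sentences over
nonempty structures). -/
def SatS {σ : Signature} (M : Struct σ) (φ : Fml σ) : Prop :=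
  ∀ f : ℕ → M.carrier, Fml.Sat M f φ

/-- `φ` distinguishes `A` from `B`: `A ⊨ φ` and `B ⊭ φ`. -/
def Distinguishes {σ : Signature} (A B : Struct σ) (φ : Fml σ) : Prop :=
  SatS A φ ∧ ¬ SatS B φ

/-- `A` and `B` agree on `φ`. -/
def AgreeOn {σ : Signature} (A B : Struct σ) (φ : Fml σ) : Prop :=
  SatS A φ ↔ SatS B φ

/-- A pebbled structure: a structure together with a partial assignment of the
variables to elements. -/
structure Pebbled (σ : Signature) : Type 1 where
  M : Struct σ
  α : ℕ → Option M.carrier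

/-- The domain of the partial assignment of a pebbled structure. -/
def Pebbled.dom {σ : Signature} (P : Pebbled σ) : Set ℕ := {i | P.α i ≠ none}

/-- A `k`-pebbled structure: only the variables `x_1, …, x_k` may be assigned. -/
def Pebbled.IsK {σ : Signature} (k : ℕ) (P : Pebbled σ) : Prop :=
  ∀ i, k ≤ i → P.α i = none

/-- Satisfaction for pebbled structures: `φ` holds under every total extension of
the partial assignment. -/
def PSat {σ : Signature} (P : Pebbled σ) (φ : Fml σ) : Prop :=
  ∀ f : ℕ → P.M.carrier, (∀ i a, P.α i = some a → f i = a) → Fml.Sat P.M f φ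

/-- Two sets of pebbled structures disagree on `φ`: every member of `𝔄`
satisfies `φ` and no member of `𝔅` does. -/
def DisagreeOn {σ : Signature} (𝔄 𝔅 : Set (Pebbled σ)) (φ : Fml σ) : Prop :=
  (∀ P ∈ 𝔄, PSat P φ) ∧ (∀ P ∈ 𝔅, ¬ PSat P φ)

namespace LB

/-! ### Reflected Gray code -/

/-- Reflected `M`-ary Gray code with `e` digits. -/
def gray (M : ℕ) : (e : ℕ) → ℕ → Fin e → ℕ
  | 0, _ => Fin.elim0
  | e + 1, t => Fin.cons (if (t / M) % 2 = 0 then t % M else M - 1 - t % M) (gray M e (t / M))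

theorem gray_lt {M : ℕ} (hM : 0 < M) : ∀ (e t : ℕ) (i : Fin e), gray M e t i < M := by
  intro e
  induction e with
  | zero => intro t i; exact i.elim0
  | succ e ih =>
    intro t i
    refine Fin.cases ?_ (fun j => ?_) i
    · have := Nat.mod_lt t hM
      simp only [gray, Fin.cons_zero]
      split_ifs <;> omega
    · simpa [gray] using ih (t / M) j

theorem gray_zero {M : ℕ} : ∀ (e : ℕ) (i : Fin e), gray M e 0 i = 0 := by
  intro e
  induction e with
  | zero => intro i; exact i.elim0
  | succ e ih =>
    intro i
    refine Fin.cases ?_ (fun j => ?_) i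
    · simp [gray]
    · simpa [gray] using ih j

theorem gray_inj {M : ℕ} (hM : 0 < M) : ∀ (e t t' : ℕ), t < M ^ e → t' < M ^ e →
    gray M e t = gray M e t' → t = t' := by
  intro e
  induction e with
  | zero => intro t t' h h' _; simp at h h'; omega
  | succ e ih =>
    intro t t' h h' heq
    have h1 : gray M e (t / M) = gray M e (t' / M) := by
      funext i
      have := congrFun heq i.succ
      simpa [gray] using this
    have h2 : t / M = t' / M := by
      apply ih _ _ _ _ h1
      · rw [Nat.div_lt_iff_lt_mul hM, ← pow_succ]; exact h
      · rw [Nat.div_lt_iff_lt_mul hM, ← pow_succ]; exact h'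
    have h3 := congrFun heq 0
    simp only [gray, Fin.cons_zero, h2] at h3
    have a1 := Nat.mod_lt t hM
    have a2 := Nat.mod_lt t' hM
    have h4 : t % M = t' % M := by
      split_ifs at h3 <;> omega
    rw [← Nat.div_add_mod t M, ← Nat.div_add_mod t' M, h2, h4]

theorem gray_step {M : ℕ} (hM : 1 < M) : ∀ (e t : ℕ), t + 1 < M ^ e →
    ∃ (i : Fin e) (l : ℕ), gray M e (t + 1) = Function.update (gray M e t) i l ∧
      (l = gray M e t i + 1 ∨ gray M e t i = l + 1) := by
  intro e
  induction e with
  | zero => intro t h; simp at h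
  | succ e ih =>
    intro t h
    have a1 := Nat.mod_lt t (show 0 < M by omega)
    have hd := Nat.div_add_mod t M
    by_cases hc : t % M + 1 = M
    · have e1 : t + 1 = M * (t / M + 1) := by rw [mul_add, mul_one]; omega
      have hdiv : (t + 1) / M = t / M + 1 := by
        rw [e1, Nat.mul_div_cancel_left _ (by omega)]
      have hmod : (t + 1) % M = 0 := by rw [e1, Nat.mul_mod_right]
      have hlt : t / M + 1 < M ^ e := by
        rw [← hdiv, Nat.div_lt_iff_lt_mul (by omega), ← pow_succ]; exact h
      obtain ⟨i, l, h1, h2⟩ := ih (t / M) hlt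
      refine ⟨i.succ, l, ?_, ?_⟩
      · funext j
        refine Fin.cases ?_ (fun j => ?_) j
        · rw [Function.update_of_ne (Fin.succ_ne_zero i).symm]
          simp only [gray, Fin.cons_zero, hdiv, hmod]
          split_ifs <;> omega
        · have := congrFun h1 j
          by_cases hj : j = i
          · subst hj; simp [gray, hdiv, this]
          · rw [Function.update_of_ne (by simpa using hj)]
            simp [gray, hdiv, this, hj]
      · simpa [gray] using h2
    · have hdiv : (t + 1) / M = t / M := by
        rw [Nat.div_eq_iff (by omega)]
        have := Nat.mul_comm M (t / M)
        constructor <;> omega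
      have hmod : (t + 1) % M = t % M + 1 := by
        have := Nat.div_add_mod (t + 1) M
        rw [hdiv] at this; omega
      refine ⟨0, gray M (e + 1) (t + 1) 0, ?_, ?_⟩
      · funext j
        refine Fin.cases ?_ (fun j => ?_) j
        · simp
        · simp [gray, hdiv]
      · simp only [gray, Fin.cons_zero, hdiv, hmod]
        split_ifs <;> omega

/-- A long walk in the grid `{0, …, M-1}^e` changing one coordinate by one at each step. -/
structure Walk (e M : ℕ) where
  N : ℕ
  hN : 0 < N
  g : ℕ → Fin e → ℕ
  gi : ℕ → Fin e
  gl : ℕ → ℕ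
  inj : ∀ t t', t ≤ N → t' ≤ N → g t = g t' → t = t'
  zero : ∀ i, g 0 i = 0
  step : ∀ t, t < N → g (t + 1) = Function.update (g t) (gi t) (gl t)
  adj : ∀ t, t < N → (gl t = g t (gi t) + 1 ∨ g t (gi t) = gl t + 1)
  gl_lt : ∀ t, t < N → gl t < M

theorem exists_walk (e M : ℕ) (he : 0 < e) (hM : 1 < M) : ∃ T : Walk e M, T.N = M ^ e - 1 := by
  have hp : 1 < M ^ e := Nat.one_lt_pow he.ne' hM
  have H : ∀ t, ∃ (i : Fin e) (l : ℕ), t < M ^ e - 1 →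
      (gray M e (t + 1) = Function.update (gray M e t) i l ∧
      (l = gray M e t i + 1 ∨ gray M e t i = l + 1)) := by
    intro t
    by_cases h : t < M ^ e - 1
    · obtain ⟨i, l, h1⟩ := gray_step hM e t (by omega)
      exact ⟨i, l, fun _ => h1⟩
    · exact ⟨⟨0, he⟩, 0, fun h' => absurd h' h⟩
  choose gi gl H using H
  refine ⟨⟨M ^ e - 1, by omega, gray M e, gi, gl, ?_, gray_zero e, fun t ht => (H t ht).1,
    fun t ht => (H t ht).2, ?_⟩, rfl⟩
  · intro t t' h h'
    exact gray_inj (by omega) e t t' (by omega) (by omega)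
  · intro t ht
    have := gray_lt (show 0 < M by omega) e (t + 1) (gi t)
    rw [(H t ht).1] at this
    simpa using this


/-! ### The combinatorial game -/

abbrev Qv (e h : ℕ) := Fin (e + 2) ⊕ (Fin (h + 2) × Bool)
abbrev Xv (e h : ℕ) := Fin (e + 1) × Qv e h
abbrev Rv (w : ℕ) := Fin (w + 3)
abbrev Cv (e h w : ℕ) := Xv e h ⊕ Rv w
abbrev Pr (e h w : ℕ) := Xv e h × Rv w
abbrev Mv (h w : ℕ) := 1 + (h + 2) * (w + 2)

section
variable {e h w : ℕ}

/-- The label of a cell (variable, value) in a group; group `0` is the control group. -/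
def lab (i : Fin (e + 1)) (x : Qv e h) (v : Rv w) : Option ℕ :=
  match x with
  | Sum.inl _ => if v.val = 1 then some 0 else none
  | Sum.inr (a, b) =>
    if i = 0 then (if v.val = 1 ∨ v.val = 2 then some (2 * b.toNat + (v.val - 1)) else none)
    else if v.val = 0 then none else some (1 + a.val + (h + 2) * (v.val - 1))

def rvar (l : ℕ) (b : Bool) : Qv e h :=
  if l = 0 then Sum.inl (if b then 1 else 0)
  else Sum.inr (⟨(l - 1) % (h + 2), Nat.mod_lt _ (by omega)⟩, b)

def rval (h w l : ℕ) : Rv w :=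
  if l = 0 then ⟨1, by omega⟩ else Fin.ofNat (w + 3) ((l - 1) / (h + 2) + 1)

def yvar (b : Bool) : Qv e h := Sum.inr (0, b)

theorem lab_zero (i : Fin (e + 1)) (x : Qv e h) (v : Rv w) (hv : v.val = 0) :
    lab i x v = none := by
  rcases x with x | ⟨a, b⟩ <;> simp [lab, hv]

theorem lab_inl (i : Fin (e + 1)) (x : Fin (e + 2)) (v : Rv w) (l : ℕ)
    (hl : lab (h := h) i (Sum.inl x) v = some l) : v.val = 1 ∧ l = 0 := by
  simp only [lab] at hl
  split_ifs at hl with h1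
  exact ⟨h1, by simpa using hl.symm⟩

theorem lab_inl_one (i : Fin (e + 1)) (x : Fin (e + 2)) (v : Rv w) (hv : v.val = 1) :
    lab (h := h) i (Sum.inl x) v = some 0 := by
  simp [lab, hv]

theorem lab_rvar (i : Fin e) (l : ℕ) (b : Bool) (hl : l < Mv h w) :
    lab (h := h) i.succ (rvar l b) (rval h w l) = some l := by
  by_cases h0 : l = 0
  · subst h0; simp [rvar, rval, lab]
  · have hq : (l - 1) / (h + 2) < w + 2 := by
      rw [Nat.div_lt_iff_lt_mul (by omega), mul_comm]; unfold Mv at hl; omega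
    have hv : (rval h w l).val = (l - 1) / (h + 2) + 1 := by
      simp only [rval, h0, if_false, Fin.ofNat]
      exact Nat.mod_eq_of_lt (by omega)
    have hd := Nat.mod_add_div (l - 1) (h + 2)
    simp only [rvar, h0, if_false, lab, hv, Fin.succ_ne_zero]
    simp only [Nat.add_sub_cancel, Nat.add_eq_zero_iff, one_ne_zero, and_false, if_false]
    congr 1
    omega

theorem lab_rvar_fresh (i : Fin e) (l l' : ℕ) (b : Bool) (x : Qv e h) (v : Rv w)
    (hadj : l = l' + 1 ∨ l' = l + 1) (hx : lab i.succ x v = some l') : x ≠ rvar l b := by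
  rintro rfl
  by_cases h0 : l = 0
  · subst h0
    simp only [rvar, if_true] at hx
    have := (lab_inl _ _ _ _ hx).2
    omega
  · simp only [rvar, h0, if_false, lab, Fin.succ_ne_zero] at hx
    split_ifs at hx with h1
    simp only [Option.some.injEq] at hx
    have hm : (l' - 1) % (h + 2) = (l - 1) % (h + 2) := by
      have h3 : l' - 1 = (l - 1) % (h + 2) + (h + 2) * (v.val - 1) := by omega
      rw [h3, Nat.add_mul_mod_self_left, Nat.mod_mod]
    have hl' : l' ≠ 0 := by omega
    have key : ∀ a : ℕ, (a + 1) % (h + 2) = a % (h + 2) → False := by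
      intro a ha
      have h4 := Nat.mod_lt a (show 0 < h + 2 by omega)
      rw [Nat.add_mod, Nat.mod_eq_of_lt (show 1 < h + 2 by omega)] at ha
      by_cases h5 : a % (h + 2) + 1 < h + 2
      · rw [Nat.mod_eq_of_lt h5] at ha; omega
      · have h6 : a % (h + 2) + 1 = h + 2 := by omega
        rw [h6, Nat.mod_self] at ha; omega
    rcases hadj with h3 | h3
    · apply key (l' - 1)
      rw [hm, show l' - 1 + 1 = l - 1 by omega]
    · apply key (l - 1)
      rw [← hm, show l - 1 + 1 = l' - 1 by omega]

theorem rvar_ne (l : ℕ) : (rvar l true : Qv e h) ≠ rvar l false := by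
  by_cases h0 : l = 0
  · simp [rvar, h0]
  · simp [rvar, h0]

theorem lab_yvar (b : Bool) (v : Rv w) (hv : v.val = 1 ∨ v.val = 2) :
    lab (e := e) (h := h) 0 (yvar b) v = some (2 * b.toNat + (v.val - 1)) := by
  simp [lab, yvar, hv]

theorem lab_yvar_fresh (b : Bool) (x : Qv e h) (v : Rv w) (c : ℕ) (hx : lab 0 x v = some c)
    (hc : c / 2 ≠ b.toNat) : x ≠ yvar b := by
  rintro rfl
  simp only [lab, yvar, if_true] at hx
  split_ifs at hx with h1
  simp only [Option.some.injEq] at hx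
  omega

/-- The abstract state at time `t` with control label `c`. -/
def stt (T : Walk e (Mv h w)) (t c : ℕ) : Fin (e + 1) → ℕ := Fin.cons c (T.g t)

theorem stt_inj (T : Walk e (Mv h w)) {t t' c c' : ℕ} (ht : t ≤ T.N) (ht' : t' ≤ T.N)
    (hs : stt T t c = stt T t' c') : t = t' ∧ c = c' := by
  constructor
  · apply T.inj _ _ ht ht'
    funext i
    have := congrFun hs i.succ
    simpa [stt] using this
  · have := congrFun hs 0
    simpa [stt] using this

theorem stt_zero (T : Walk e (Mv h w)) : stt T 0 0 = fun _ => 0 := by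
  funext i
  refine Fin.cases ?_ (fun j => ?_) i
  · simp [stt]
  · simp [stt, T.zero]

theorem stt_upd0 (T : Walk e (Mv h w)) (t c c' : ℕ) :
    Function.update (stt T t c) 0 c' = stt T t c' := by
  funext i
  refine Fin.cases ?_ (fun j => ?_) i
  · simp [stt]
  · rw [Function.update_of_ne (Fin.succ_ne_zero j)]; simp [stt]

theorem stt_updS (T : Walk e (Mv h w)) (t c : ℕ) (ht : t < T.N) :
    Function.update (stt T t c) (T.gi t).succ (T.gl t) = stt T (t + 1) c := by
  funext i
  refine Fin.cases ?_ (fun j => ?_) i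
  · rw [Function.update_of_ne (Fin.succ_ne_zero _).symm]; simp [stt]
  · simp only [stt, Fin.cons_succ, T.step t ht]
    by_cases hj : j = T.gi t
    · subst hj; simp
    · rw [Function.update_of_ne (by simpa using hj), Function.update_of_ne hj]; simp

def odd (c : ℕ) : Bool := decide (c % 2 = 1)

theorem odd_toNat (c : ℕ) : (odd c).toNat = c % 2 := by
  unfold odd
  rcases Nat.mod_two_eq_zero_or_one c with h | h <;> simp [h]

/-- `Rule T s i x V`: in the state `s` the variable `x` of group `i` must get a value in `V`. -/
inductive Rule (T : Walk e (Mv h w)) : (Fin (e + 1) → ℕ) → Fin (e + 1) → Qv e h →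
    (Rv w → Prop) → Prop
  | br (t c : ℕ) : t ≤ T.N → c < 4 → c / 2 = t % 2 →
      Rule T (stt T t c) 0 (yvar (odd (t + 1))) (fun v => t < T.N ∧ (v.val = 1 ∨ v.val = 2))
  | mv (t c : ℕ) : t < T.N → c < 4 → c / 2 ≠ t % 2 →
      Rule T (stt T t c) (T.gi t).succ (rvar (T.gl t) (odd c)) (fun v => v = rval h w (T.gl t))

/-- Case analysis for rules out of a given state. -/
theorem Rule.cases' {T : Walk e (Mv h w)} {s i x V} (hr : Rule T s i x V) :
    ∃ t c, t ≤ T.N ∧ c < 4 ∧ s = stt T t c ∧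
      ((c / 2 = t % 2 ∧ i = 0 ∧ x = yvar (odd (t + 1)) ∧
          V = fun v => t < T.N ∧ (v.val = 1 ∨ v.val = 2)) ∨
        (c / 2 ≠ t % 2 ∧ t < T.N ∧ i = (T.gi t).succ ∧ x = rvar (T.gl t) (odd c) ∧
          V = fun v => v = rval h w (T.gl t))) := by
  cases hr with
  | br t c h1 h2 h3 => exact ⟨t, c, h1, h2, rfl, Or.inl ⟨h3, rfl, rfl, rfl⟩⟩
  | mv t c h1 h2 h3 => exact ⟨t, c, h1.le, h2, rfl, Or.inr ⟨h3, h1, rfl, rfl, rfl⟩⟩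

theorem Rule.at {T : Walk e (Mv h w)} {t c i x V} (ht : t ≤ T.N) (hr : Rule T (stt T t c) i x V) :
      c < 4 ∧ ((c / 2 = t % 2 ∧ i = 0 ∧ x = yvar (odd (t + 1)) ∧
          V = fun v => t < T.N ∧ (v.val = 1 ∨ v.val = 2)) ∨
        (c / 2 ≠ t % 2 ∧ t < T.N ∧ i = (T.gi t).succ ∧ x = rvar (T.gl t) (odd c) ∧
          V = fun v => v = rval h w (T.gl t))) := by
  obtain ⟨t', c', h1, h2, h3, h4⟩ := hr.cases'
  obtain ⟨rfl, rfl⟩ := stt_inj T ht h1 h3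
  exact ⟨h2, h4⟩

theorem Rule.det {T : Walk e (Mv h w)} {s i x V i' x' V'} (hr : Rule T s i x V)
    (hr' : Rule T s i' x' V') : i = i' ∧ x = x' ∧ V = V' := by
  obtain ⟨t, c, h1, h2, rfl, h4⟩ := hr.cases'
  obtain ⟨_, h5⟩ := hr'.at h1
  rcases h4 with ⟨a, rfl, rfl, rfl⟩ | ⟨a, _, rfl, rfl, rfl⟩ <;>
  rcases h5 with ⟨b, rfl, rfl, rfl⟩ | ⟨b, _, rfl, rfl, rfl⟩ <;> first | exact ⟨rfl, rfl, rfl⟩ | omega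

theorem Rule.fresh {T : Walk e (Mv h w)} {s i x V} (hr : Rule T s i x V) {x' : Qv e h} {v' : Rv w}
    (hl : lab i x' v' = some (s i)) : x' ≠ x := by
  obtain ⟨t, c, h1, h2, rfl, h4⟩ := hr.cases'
  rcases h4 with ⟨a, rfl, rfl, rfl⟩ | ⟨a, ht, rfl, rfl, rfl⟩
  · apply lab_yvar_fresh _ _ _ _ hl
    simp only [stt, Fin.cons_zero, odd_toNat]; omega
  · apply lab_rvar_fresh _ _ _ _ _ _ _ hl
    simpa [stt] using T.adj t ht

/-- The outcome of a rule. -/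
theorem Rule.out {T : Walk e (Mv h w)} {s i x V} (hr : Rule T s i x V) {v : Rv w} (hv : V v) :
    ∃ l, lab i x v = some l ∧ ∀ i' x' V', Rule T (Function.update s i l) i' x' V' → i' ≠ i := by
  obtain ⟨t, c, h1, h2, rfl, h4⟩ := hr.cases'
  rcases h4 with ⟨a, rfl, rfl, rfl⟩ | ⟨a, ht, rfl, rfl, rfl⟩
  · refine ⟨_, lab_yvar _ _ hv.2, ?_⟩
    intro i' x' V' hr'
    rw [stt_upd0] at hr'
    obtain ⟨_, h5⟩ := hr'.at h1
    rw [odd_toNat] at h5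
    rcases h5 with ⟨b, rfl, rfl, rfl⟩ | ⟨b, _, rfl, rfl, rfl⟩
    · rcases hv.2 with h6 | h6 <;> rw [h6] at b <;> omega
    · exact Fin.succ_ne_zero _
  · subst hv
    refine ⟨_, lab_rvar _ _ _ (T.gl_lt t ht), ?_⟩
    intro i' x' V' hr'
    rw [stt_updS T t c ht] at hr'
    obtain ⟨_, h5⟩ := hr'.at (show t + 1 ≤ T.N by omega)
    rcases h5 with ⟨b, rfl, rfl, rfl⟩ | ⟨b, _, rfl, rfl, rfl⟩
    · exact (Fin.succ_ne_zero _).symm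
    · omega

theorem Rule.zero {T : Walk e (Mv h w)} : ∃ V, Rule T (fun _ => 0) 0 (yvar (odd 1)) V ∧ ∃ v, V v := by
  have := Rule.br (T := T) 0 0 (by omega) (by omega) (by omega)
  rw [stt_zero] at this
  exact ⟨_, this, ⟨1, by omega⟩, T.hN, Or.inl rfl⟩

theorem Rule.zero_x {T : Walk e (Mv h w)} {i x V} (hr : Rule T (fun _ => 0) i x V) :
    ∃ z, x = Sum.inr z := by
  obtain ⟨V', h, _⟩ := Rule.zero (T := T)
  obtain ⟨_, h2, _⟩ := hr.det h
  exact ⟨_, h2⟩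
end

section
variable {e h w : ℕ}

def st (σ : Fin (e + 1) → Qv e h × Rv w) : Set (Pr e h w) :=
  Set.range fun i => ((i, (σ i).1), (σ i).2)

def Lab (σ : Fin (e + 1) → Qv e h × Rv w) (s : Fin (e + 1) → ℕ) : Prop :=
  ∀ i, lab i (σ i).1 (σ i).2 = some (s i)

def Contains (P : Set (Pr e h w)) (s : Fin (e + 1) → ℕ) : Prop := ∃ σ, Lab σ s ∧ st σ ⊆ P

def Live (P : Set (Pr e h w)) : Set (Pr e h w) := {p | p ∈ P ∧ lab p.1.1 p.1.2 p.2 ≠ none}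

def BadM (T : Walk e (Mv h w)) (P : Set (Pr e h w)) : Prop :=
  ∃ s i x V v, Rule T s i x V ∧ Contains P s ∧ ¬ V v ∧ ((i, x), v) ∈ P

def BadS (P : Set (Pr e h w)) : Prop :=
  ∃ m : Fin (e + 1), (∀ l, l < m → ∃ (x : Fin (e + 2)) (v : Rv w), v.val = 1 ∧
      (((l, Sum.inl x), v) : Pr e h w) ∈ P) ∧
    ∀ x : Fin (e + 2), x.val < e + 2 - m.val →
      ∃ v : Rv w, v.val ≠ 1 ∧ (((m, Sum.inl x), v) : Pr e h w) ∈ P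

def Bad (T : Walk e (Mv h w)) (P : Set (Pr e h w)) : Prop := BadM T P ∨ BadS P

def Shape (T : Walk e (Mv h w)) (P : Set (Pr e h w)) : Prop :=
  ∃ s σ i x V v, Rule T s i x V ∧ V v ∧ Lab σ s ∧ Live P ⊆ insert ((i, x), v) (st σ)

theorem Contains.mono {P P' : Set (Pr e h w)} {s} (hPP : P ⊆ P') (hc : Contains P s) :
    Contains P' s := by
  obtain ⟨σ, h1, h2⟩ := hc
  exact ⟨σ, h1, h2.trans hPP⟩

theorem Live.mono {P P' : Set (Pr e h w)} (hPP : P ⊆ P') : Live P ⊆ Live P' :=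
  fun p hp => ⟨hPP hp.1, hp.2⟩

theorem Bad.mono {T : Walk e (Mv h w)} {P P' : Set (Pr e h w)} (hPP : P ⊆ P') (hb : Bad T P) :
    Bad T P' := by
  rcases hb with ⟨s, i, x, V, v, h1, h2, h3, h4⟩ | ⟨m, h1, h2⟩
  · exact Or.inl ⟨s, i, x, V, v, h1, h2.mono hPP, h3, hPP h4⟩
  · refine Or.inr ⟨m, fun l hl => ?_, fun x hx => ?_⟩
    · obtain ⟨x, v, hv, hp⟩ := h1 l hl
      exact ⟨x, v, hv, hPP hp⟩
    · obtain ⟨v, hv, hp⟩ := h2 x hx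
      exact ⟨v, hv, hPP hp⟩

theorem Shape.mono {T : Walk e (Mv h w)} {P P' : Set (Pr e h w)} (hPP : P ⊆ P')
    (hs : Shape T P') : Shape T P := by
  obtain ⟨s, σ, i, x, V, v, h1, h2, h3, h4⟩ := hs
  exact ⟨s, σ, i, x, V, v, h1, h2, h3, (Live.mono hPP).trans h4⟩

theorem mem_st (σ : Fin (e + 1) → Qv e h × Rv w) (i) : ((i, (σ i).1), (σ i).2) ∈ st σ :=
  ⟨i, rfl⟩

theorem of_mem_st {σ : Fin (e + 1) → Qv e h × Rv w} {i x v} (hp : ((i, x), v) ∈ st σ) :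
    σ i = (x, v) := by
  obtain ⟨j, hj⟩ := hp
  simp only [Prod.mk.injEq] at hj
  obtain ⟨⟨rfl, rfl⟩, rfl⟩ := hj
  rfl

theorem st_ncard (σ : Fin (e + 1) → Qv e h × Rv w) : (st σ).ncard = e + 1 := by
  unfold st
  rw [← Set.image_univ, Set.ncard_image_of_injective, Set.ncard_univ]
  · simp
  · intro i j hij
    simp only [Prod.mk.injEq] at hij
    exact hij.1.1

theorem st_live {σ : Fin (e + 1) → Qv e h × Rv w} {s} (hL : Lab σ s) {P} (hP : st σ ⊆ P) :
    st σ ⊆ Live P := by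
  intro p hp
  refine ⟨hP hp, ?_⟩
  obtain ⟨i, rfl⟩ := hp
  simp [hL i]

theorem st_sub {σ σ' : Fin (e + 1) → Qv e h × Rv w} {i x v}
    (hs : st σ' ⊆ insert ((i, x), v) (st σ)) : σ' = σ ∨ σ' = Function.update σ i (x, v) := by
  have H : ∀ j, j ≠ i → σ' j = σ j := by
    intro j hj
    rcases hs (mem_st σ' j) with h1 | h1
    · simp only [Prod.mk.injEq] at h1
      exact absurd h1.1.1 hj
    · exact (of_mem_st h1).symm
  rcases hs (mem_st σ' i) with h1 | h1
  · right
    funext j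
    by_cases hj : j = i
    · subst hj
      simp only [Prod.mk.injEq, true_and] at h1
      rw [Function.update_self]
      exact Prod.ext h1.1 h1.2
    · rw [Function.update_of_ne hj, H j hj]
  · left
    funext j
    by_cases hj : j = i
    · subst hj
      exact (of_mem_st h1).symm
    · exact H j hj

theorem Lab.inj {σ : Fin (e + 1) → Qv e h × Rv w} {s s'} (h1 : Lab σ s) (h2 : Lab σ s') :
    s = s' := by
  funext i
  have := (h1 i).symm.trans (h2 i)
  simpa using this

theorem Lab.upd {σ : Fin (e + 1) → Qv e h × Rv w} {s} (h1 : Lab σ s) {i x v l}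
    (hl : lab i x v = some l) : Lab (Function.update σ i (x, v)) (Function.update s i l) := by
  intro j
  by_cases hj : j = i
  · subst hj; simp [hl]
  · simp [hj, h1 j]

theorem Lab.upd_lab {σ : Fin (e + 1) → Qv e h × Rv w} {s'} {i x v}
    (h2 : Lab (Function.update σ i (x, v)) s') : lab i x v = some (s' i) := by
  have := h2 i
  simpa using this

/-- States contained in a board with live part inside an edge. -/
theorem contains_edge {P : Set (Pr e h w)} {σ s i x v} (hL : Lab σ s)
    (hP : Live P ⊆ insert ((i, x), v) (st σ)) {s'} (hc : Contains P s') :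
    s' = s ∨ ∃ l, lab i x v = some l ∧ s' = Function.update s i l := by
  obtain ⟨σ', h1, h2⟩ := hc
  rcases st_sub ((st_live h1 h2).trans hP) with rfl | rfl
  · exact Or.inl (h1.inj hL)
  · right
    have hl := h1.upd_lab
    exact ⟨s' i, hl, h1.inj (hL.upd hl)⟩

theorem contains_insert {Q : Set (Pr e h w)} {a v s} (hv : lab a.1 a.2 v = none)
    (hc : Contains (insert (a, v) Q) s) : Contains Q s := by
  obtain ⟨σ, h1, h2⟩ := hc
  refine ⟨σ, h1, fun p hp => ?_⟩
  rcases h2 hp with h3 | h3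
  · obtain ⟨i, rfl⟩ := hp
    have h4 := h1 i
    simp only [Prod.ext_iff] at h3
    obtain ⟨⟨h5, h6⟩, h7⟩ := h3
    rw [h6, h7, h5] at h4
    rw [h4] at hv
    simp at hv
  · exact h3

theorem live_insert {Q : Set (Pr e h w)} {a v} (hv : lab a.1 a.2 v = none) :
    Live (insert (a, v) Q) ⊆ Live Q := by
  rintro p ⟨hp, hl⟩
  rcases hp with rfl | hp
  · exact absurd hv hl
  · exact ⟨hp, hl⟩

/-- Answering according to a main rule. -/
theorem good_main {T : Walk e (Mv h w)} {s σ i x V v} (hr : Rule T s i x V) (hL : Lab σ s)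
    (hv : V v) : ¬ Bad T (insert ((i, x), v) (st σ)) ∧ Shape T (insert ((i, x), v) (st σ)) := by
  obtain ⟨l, hl, hout⟩ := hr.out hv
  constructor
  · rintro (⟨s2, i2, x2, V2, v2, h1, h2, h3, h4⟩ | ⟨m, h1, h2⟩)
    · rcases contains_edge hL (fun p hp => hp.1) h2 with rfl | ⟨l', hl', rfl⟩
      · obtain ⟨rfl, rfl, rfl⟩ := hr.det h1
        rcases h4 with h5 | h5
        · simp only [Prod.mk.injEq, true_and] at h5
          subst h5; exact h3 hv
        · have h6 := of_mem_st h5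
          have := hL i
          rw [h6] at this
          exact hr.fresh this rfl
      · rw [hl] at hl'
        simp only [Option.some.injEq] at hl'
        subst hl'
        have hne := hout _ _ _ h1
        rcases h4 with h5 | h5
        · simp only [Prod.mk.injEq] at h5
          exact hne h5.1.1
        · have h6 := of_mem_st h5
          have h7 := hL i2
          rw [h6] at h7
          apply h1.fresh (x' := x2) (v' := v2) _ rfl
          rw [Function.update_of_ne hne]
          exact h7
    · obtain ⟨v', hv', hp⟩ := h2 0 (by have := m.2; simp; omega)
      have hlab : lab (h := h) m (Sum.inl 0) v' ≠ none := by
        rcases hp with h5 | h5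
        · simp only [Prod.mk.injEq] at h5
          obtain ⟨⟨rfl, rfl⟩, rfl⟩ := h5
          simp [hl]
        · have h6 := of_mem_st h5
          have h7 := hL m
          rw [h6] at h7
          simp [h7]
      obtain ⟨l', hl'⟩ := Option.ne_none_iff_exists'.1 hlab
      exact hv' (lab_inl _ _ _ _ hl').1
  · exact ⟨s, σ, i, x, V, v, hr, hv, hL, fun p hp => hp.1⟩

/-- The exact shape of the board when a start rule fires. -/
theorem start_exact {Q : Set (Pr e h w)} (hfin : Q.Finite) (hcard : Q.ncard ≤ e + 1)
    (m : Fin (e + 1)) (a : Fin (e + 2)) (ha : a.val < e + 2 - m.val)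
    (xs : Fin (e + 1) → Fin (e + 2)) (vs : Fin (e + 1) → Rv w)
    (h1 : ∀ l, l < m → (((l, Sum.inl (xs l)), vs l) : Pr e h w) ∈ Q)
    (vy : Fin (e + 2) → Rv w)
    (h2 : ∀ x : Fin (e + 2), x.val < e + 2 - m.val → x ≠ a →
      (((m, Sum.inl x), vy x) : Pr e h w) ∈ Q) :
    ∀ p ∈ Q, (∃ l, l < m ∧ p = ((l, Sum.inl (xs l)), vs l)) ∨
      ∃ x : Fin (e + 2), x.val < e + 2 - m.val ∧ x ≠ a ∧ p = ((m, Sum.inl x), vy x) := by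
  classical
  let F1 : Finset (Pr e h w) := (Finset.Iio m).image fun l => ((l, Sum.inl (xs l)), vs l)
  let F2 : Finset (Pr e h w) := ((Finset.univ.filter
    (fun x : Fin (e + 2) => x.val < e + 2 - m.val)).erase a).image fun x => ((m, Sum.inl x), vy x)
  have c1 : F1.card = m.val := by
    rw [Finset.card_image_of_injective, Fin.card_Iio]
    intro i j hij
    simp only [Prod.mk.injEq] at hij
    exact hij.1.1
  have c2 : F2.card = e + 1 - m.val := by
    rw [Finset.card_image_of_injective, Finset.card_erase_of_mem]
    · rw [Fin.card_filter_val_lt]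
      have := m.2
      omega
    · simp [ha]
    · intro i j hij
      simp only [Prod.mk.injEq, Sum.inl.injEq, true_and] at hij
      exact hij.1
  have hdis : Disjoint F1 F2 := by
    rw [Finset.disjoint_left]
    intro p hp hp'
    simp only [F1, F2, Finset.mem_image, Finset.mem_Iio] at hp hp'
    obtain ⟨l, hl, rfl⟩ := hp
    obtain ⟨x, _, hx⟩ := hp'
    simp only [Prod.mk.injEq] at hx
    exact hl.ne hx.1.1.symm
  have hsub : ((F1 ∪ F2 : Finset (Pr e h w)) : Set (Pr e h w)) ⊆ Q := by
    intro p hp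
    simp only [F1, F2, Finset.coe_union, Set.mem_union, Finset.mem_coe, Finset.mem_image,
      Finset.mem_Iio, Finset.mem_erase, Finset.mem_filter, Finset.mem_univ, true_and] at hp
    rcases hp with ⟨l, hl, rfl⟩ | ⟨x, ⟨hxa, hx⟩, rfl⟩
    · exact h1 l hl
    · exact h2 x hx hxa
  have heq : ((F1 ∪ F2 : Finset (Pr e h w)) : Set (Pr e h w)) = Q := by
    apply Set.eq_of_subset_of_ncard_le hsub _ hfin
    rw [Set.ncard_coe_finset, Finset.card_union_of_disjoint hdis, c1, c2]
    have := m.2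
    omega
  intro p hp
  rw [← heq] at hp
  simp only [F1, F2, Finset.coe_union, Set.mem_union, Finset.mem_coe, Finset.mem_image,
      Finset.mem_Iio, Finset.mem_erase, Finset.mem_filter, Finset.mem_univ, true_and] at hp
  rcases hp with ⟨l, hl, rfl⟩ | ⟨x, ⟨hxa, hx⟩, rfl⟩
  · exact Or.inl ⟨l, hl, rfl⟩
  · exact Or.inr ⟨x, hx, hxa, rfl⟩

/-- The extension lemma: how the Duplicator answers. -/
theorem ext {T : Walk e (Mv h w)} {Q : Set (Pr e h w)} (hfin : Q.Finite) (hcard : Q.ncard ≤ e + 1)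
    (hb : ¬ Bad T Q) (hS : Shape T Q) (a : Xv e h) :
    (¬ Bad T (insert (a, 0) Q) ∧ Shape T (insert (a, 0) Q)) ∨
    (∃ s σ V, Rule T s a.1 a.2 V ∧ Lab σ s ∧ Q = st σ) ∨
    (∃ v : Rv w, ¬ Bad T (insert (a, v) Q) ∧ Shape T (insert (a, v) Q) ∧
      ∀ p ∈ insert (a, v) Q, ∃ x, p.1.2 = Sum.inl x) := by
  classical
  have h0 : lab a.1 a.2 (0 : Rv w) = none := lab_zero _ _ _ rfl
  by_cases hj : Bad T (insert (a, 0) Q)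
  swap
  · left
    refine ⟨hj, ?_⟩
    obtain ⟨s, σ, i, x, V, v, h1, h2, h3, h4⟩ := hS
    exact ⟨s, σ, i, x, V, v, h1, h2, h3, (live_insert h0).trans h4⟩
  right
  rcases hj with ⟨s, i, x, V, v, h1, h2, h3, h4⟩ | ⟨m, h1, h2⟩
  · left
    have h5 := contains_insert h0 h2
    rcases h4 with h6 | h6
    swap
    · exact absurd (Or.inl ⟨s, i, x, V, v, h1, h5, h3, h6⟩) hb
    simp only [Prod.mk.injEq] at h6
    obtain ⟨rfl, rfl⟩ := h6
    obtain ⟨σ, h7, h8⟩ := h5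
    refine ⟨s, σ, V, h1, h7, (Set.eq_of_subset_of_ncard_le h8 ?_ hfin).symm⟩
    rw [st_ncard]; exact hcard
  · right
    have h1' : ∀ l, ∃ (x : Fin (e + 2)) (v : Rv w), l < m → v.val = 1 ∧
        (((l, Sum.inl x), v) : Pr e h w) ∈ Q := by
      intro l
      by_cases hl : l < m
      · obtain ⟨x, v, hv, hp⟩ := h1 l hl
        rcases hp with hp | hp
        · simp only [Prod.mk.injEq] at hp
          rw [hp.2] at hv
          simp at hv
        · exact ⟨x, v, fun _ => ⟨hv, hp⟩⟩
      · exact ⟨0, 0, fun h => absurd h hl⟩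
    choose xs vs h1' using h1'
    have hex : ∃ y : Fin (e + 2), y.val < e + 2 - m.val ∧ a = (m, Sum.inl y) := by
      by_contra hno
      push Not at hno
      apply hb
      refine Or.inr ⟨m, fun l hl => ⟨_, _, h1' l hl⟩, fun x hx => ?_⟩
      obtain ⟨v, hv, hp⟩ := h2 x hx
      rcases hp with hp | hp
      · simp only [Prod.mk.injEq] at hp
        exact absurd hp.1.symm (hno x hx)
      · exact ⟨v, hv, hp⟩
    obtain ⟨y, hy, rfl⟩ := hex
    have h2' : ∀ x : Fin (e + 2), ∃ v : Rv w, x.val < e + 2 - m.val → x ≠ y → v.val ≠ 1 ∧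
        (((m, Sum.inl x), v) : Pr e h w) ∈ Q := by
      intro x
      by_cases hx : x.val < e + 2 - m.val ∧ x ≠ y
      · obtain ⟨v, hv, hp⟩ := h2 x hx.1
        rcases hp with hp | hp
        · simp only [Prod.mk.injEq, Sum.inl.injEq, true_and] at hp
          exact absurd hp.1 hx.2
        · exact ⟨v, fun _ _ => ⟨hv, hp⟩⟩
      · exact ⟨0, fun h h' => absurd ⟨h, h'⟩ hx⟩
    choose vy h2' using h2'
    have hex := start_exact hfin hcard m y hy xs vs (fun l hl => (h1' l hl).2) vy
      (fun x hx hxy => (h2' x hx hxy).2)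
    have h1r : ((1 : Rv w)).val = 1 := rfl
    -- description of the new board
    have hnew : ∀ p ∈ insert (((m, Sum.inl y), 1) : Pr e h w) Q,
        (∃ l, l < m ∧ p = ((l, Sum.inl (xs l)), vs l)) ∨ p = ((m, Sum.inl y), 1) ∨
        ∃ x : Fin (e + 2), x.val < e + 2 - m.val ∧ x ≠ y ∧ p = ((m, Sum.inl x), vy x) := by
      intro p hp
      rcases hp with rfl | hp
      · exact Or.inr (Or.inl rfl)
      · rcases hex p hp with h | h
        · exact Or.inl h
        · exact Or.inr (Or.inr h)
    have hinl : ∀ p ∈ insert (((m, Sum.inl y), 1) : Pr e h w) Q, ∃ x, p.1.2 = Sum.inl x := by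
      intro p hp
      rcases hnew p hp with ⟨l, _, rfl⟩ | rfl | ⟨x, _, _, rfl⟩ <;> exact ⟨_, rfl⟩
    refine ⟨1, ?_, ?_, hinl⟩
    · rintro (⟨s, i, x, V, v, g1, g2, g3, g4⟩ | ⟨m2, g1, g2⟩)
      · have hs : s = fun _ => 0 := by
          obtain ⟨σ, q1, q2⟩ := g2
          funext l
          obtain ⟨z, hz⟩ := hinl _ (q2 (mem_st σ l))
          have := q1 l
          dsimp at hz
          rw [hz] at this
          exact (lab_inl _ _ _ _ this).2
        subst hs
        obtain ⟨z, rfl⟩ := g1.zero_x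
        obtain ⟨z', hz'⟩ := hinl _ g4
        simp at hz'
      · rcases lt_trichotomy m2 m with hm | rfl | hm
        · obtain ⟨v, hv, hp⟩ := g2 0 (by have := m2.2; simp; omega)
          rcases hnew _ hp with ⟨l, hl, hp⟩ | hp | ⟨x, _, _, hp⟩
          · simp only [Prod.mk.injEq] at hp
            obtain ⟨⟨rfl, _⟩, rfl⟩ := hp
            exact hv (h1' _ hl).1
          · simp only [Prod.mk.injEq] at hp
            exact hm.ne hp.1.1
          · simp only [Prod.mk.injEq] at hp
            exact hm.ne hp.1.1
        · obtain ⟨v, hv, hp⟩ := g2 y hy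
          rcases hnew _ hp with ⟨l, hl, hp⟩ | hp | ⟨x, _, hxy, hp⟩
          · simp only [Prod.mk.injEq] at hp
            exact hl.ne hp.1.1.symm
          · simp only [Prod.mk.injEq, true_and] at hp
            rw [hp] at hv
            exact hv rfl
          · simp only [Prod.mk.injEq, Sum.inl.injEq, true_and] at hp
            exact hxy hp.1.symm
        · obtain ⟨v, hv, hp⟩ := g2 0 (by have := m2.2; simp; omega)
          rcases hnew _ hp with ⟨l, hl, hp⟩ | hp | ⟨x, _, _, hp⟩
          · simp only [Prod.mk.injEq] at hp
            rw [hp.1.1] at hm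
            exact lt_asymm hl hm
          · simp only [Prod.mk.injEq] at hp
            exact hm.ne hp.1.1.symm
          · simp only [Prod.mk.injEq] at hp
            exact hm.ne hp.1.1.symm
    · obtain ⟨V, hV, v, hv⟩ := Rule.zero (T := T)
      refine ⟨_, fun l => (Sum.inl (if l = m then y else xs l), 1), _, _, V, v, hV, hv, ?_, ?_⟩
      · intro l
        exact lab_inl_one _ _ _ rfl
      · rintro p ⟨hp, hl⟩
        right
        rcases hnew _ hp with ⟨l, hlm, rfl⟩ | rfl | ⟨x, hx, hxy, rfl⟩
        · refine ⟨l, ?_⟩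
          have : vs l = 1 := Fin.ext (h1' l hlm).1
          simp [hlm.ne, this]
        · exact ⟨m, by simp⟩
        · obtain ⟨l', hl'⟩ := Option.ne_none_iff_exists'.1 hl
          exact absurd (lab_inl _ _ _ _ hl').1 (h2' x hx hxy).1
end

/-! ### Structures and boards -/

section
variable {e h w : ℕ}

/-- The board described by two tuples. -/
def tb (a b : Fin (e + 2) → Cv e h w) : Set (Pr e h w) :=
  {p | ∃ i, a i = Sum.inl p.1 ∧ b i = Sum.inr p.2}

def rB (T : Walk e (Mv h w)) (a b : Fin (e + 2) → Cv e h w) : Prop :=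
  (∀ i, ∃ v, b i = Sum.inr v) ∧ ¬ Bad T (tb a b)

def sig (e h w : ℕ) : Signature where
  symbols := Fin (e + 2) → Cv e h w
  fin := inferInstance
  arity := fun _ => e + 2

def SB (T : Walk e (Mv h w)) : Struct (sig e h w) where
  carrier := Cv e h w
  rel := fun a b => rB T a b

def SA (T : Walk e (Mv h w)) : Struct (sig e h w) where
  carrier := Cv e h w
  rel := fun a b => b = a ∨ rB T a b

def brd (f g : ℕ → Cv e h w) : Set (Pr e h w) :=
  {p | ∃ i, i < e + 2 ∧ f i = Sum.inl p.1 ∧ g i = Sum.inr p.2}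

def brdj (j : ℕ) (f g : ℕ → Cv e h w) : Set (Pr e h w) :=
  {p | ∃ i, i < e + 2 ∧ i ≠ j ∧ f i = Sum.inl p.1 ∧ g i = Sum.inr p.2}

structure Inv (T : Walk e (Mv h w)) (f g : ℕ → Cv e h w) : Prop where
  c1 : ∀ i, i < e + 2 → ∀ v, f i = Sum.inr v → g i = Sum.inr v
  c2 : ∀ i, i < e + 2 → ∀ X, f i = Sum.inl X → ∃ v, g i = Sum.inr v
  c3 : ∀ i j, i < e + 2 → j < e + 2 → f i = f j → g i = g j
  c4 : ¬ Bad T (brd f g)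
  c5 : Shape T (brd f g)

theorem brdj_sub (j : ℕ) (f g : ℕ → Cv e h w) : brdj j f g ⊆ brd f g := by
  rintro p ⟨i, h1, _, h2⟩
  exact ⟨i, h1, h2⟩

theorem brdj_sub_upd (j : ℕ) (f g : ℕ → Cv e h w) (a b) :
    brdj j f g ⊆ brd (Function.update f j a) (Function.update g j b) := by
  rintro p ⟨i, h1, h2, h3⟩
  refine ⟨i, h1, ?_⟩
  simpa [h2] using h3

theorem brd_upd_inr (j : ℕ) (f g : ℕ → Cv e h w) (v b) :
    brd (Function.update f j (Sum.inr v)) (Function.update g j b) ⊆ brdj j f g := by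
  rintro p ⟨i, h1, h3, h4⟩
  by_cases hi : i = j
  · subst hi; simp at h3
  · refine ⟨i, h1, hi, ?_⟩
    simpa [hi] using And.intro h3 h4

theorem brd_upd_inl (j : ℕ) (hj : j < e + 2) (f g : ℕ → Cv e h w) (X v) :
    brd (Function.update f j (Sum.inl X)) (Function.update g j (Sum.inr v)) =
      insert (X, v) (brdj j f g) := by
  apply Set.Subset.antisymm
  · rintro p ⟨i, h1, h3, h4⟩
    by_cases hi : i = j
    · subst hi
      simp at h3 h4
      left
      rw [h3, h4]
    · right
      refine ⟨i, h1, hi, ?_⟩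
      simpa [hi] using And.intro h3 h4
  · rintro p (rfl | hp)
    · exact ⟨j, hj, by simp⟩
    · exact brdj_sub_upd _ _ _ _ _ hp

theorem brdj_fin (j : ℕ) (hj : j < e + 2) (f g : ℕ → Cv e h w) :
    (brdj j f g).Finite ∧ (brdj j f g).ncard ≤ e + 1 := by
  classical
  let F : Finset (Pr e h w) := ((Finset.range (e + 2)).erase j).image fun m =>
    ((f m).elim id (fun _ => (0, Sum.inl 0)), (g m).elim (fun _ => 0) id)
  have hs : brdj j f g ⊆ (F : Set (Pr e h w)) := by
    rintro p ⟨i, h1, h2, h3, h4⟩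
    simp only [F, Finset.coe_image, Set.mem_image, Finset.mem_coe, Finset.mem_erase,
      Finset.mem_range]
    refine ⟨i, ⟨h2, h1⟩, ?_⟩
    rw [h3, h4]
    rfl
  refine ⟨F.finite_toSet.subset hs, ?_⟩
  refine (Set.ncard_le_ncard hs F.finite_toSet).trans ?_
  rw [Set.ncard_coe_finset]
  refine Finset.card_image_le.trans ?_
  rw [Finset.card_erase_of_mem (by simpa using hj)]
  simp

theorem inv_upd {T : Walk e (Mv h w)} {f g : ℕ → Cv e h w} (hI : Inv T f g) (j : ℕ)
    {a b} (h1 : ∀ v, a = Sum.inr v → b = Sum.inr v) (h2 : ∀ X, a = Sum.inl X → ∃ v, b = Sum.inr v)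
    (h3 : ∀ i, i < e + 2 → i ≠ j → f i = a → g i = b)
    (h4 : ¬ Bad T (brd (Function.update f j a) (Function.update g j b)))
    (h5 : Shape T (brd (Function.update f j a) (Function.update g j b))) :
    Inv T (Function.update f j a) (Function.update g j b) := by
  refine ⟨?_, ?_, ?_, h4, h5⟩
  · intro i hi v
    by_cases hij : i = j
    · subst hij; simpa using h1 v
    · simpa [hij] using hI.c1 i hi v
  · intro i hi v
    by_cases hij : i = j
    · subst hij; simpa using h2 v
    · simpa [hij] using hI.c2 i hi v
  · intro i i' hi hi'
    by_cases hij : i = j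
    · subst hij
      by_cases hij' : i' = i
      · subst hij'; simp
      · simp only [Function.update_self, Function.update_of_ne hij', ne_eq]
        intro hh
        exact (h3 i' hi' hij' hh.symm).symm
    · by_cases hij' : i' = j
      · subst hij'
        simp only [Function.update_self, Function.update_of_ne hij, ne_eq]
        exact h3 i hi hij
      · simp only [Function.update_of_ne hij', Function.update_of_ne hij, ne_eq]
        exact hI.c3 i i' hi hi'

/-- The answer of the Duplicator. -/
theorem answer {T : Walk e (Mv h w)} {f g : ℕ → Cv e h w} (hI : Inv T f g) (j : ℕ)
    (hj : j < e + 2) (a : Cv e h w) :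
    (∃ b, Inv T (Function.update f j a) (Function.update g j b) ∧
      ∀ s, Contains (brd (Function.update f j a) (Function.update g j b)) s →
        Contains (brdj j f g) s) ∨
    (∃ s σ V i x, Rule T s i x V ∧ Lab σ s ∧ brdj j f g = st σ ∧
      ∀ v, V v → Inv T (Function.update f j a) (Function.update g j (Sum.inr v)) ∧
        brd (Function.update f j a) (Function.update g j (Sum.inr v)) =
          insert ((i, x), v) (st σ)) ∨
    (∃ b, Inv T (Function.update f j a) (Function.update g j b) ∧
      ∀ s, Contains (brd (Function.update f j a) (Function.update g j b)) s →
        s = stt T 0 0) := by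
  have hnb : ¬ Bad T (brdj j f g) := fun hb => hI.c4 (hb.mono (brdj_sub j f g))
  have hns : Shape T (brdj j f g) := hI.c5.mono (brdj_sub j f g)
  rcases a with X | v
  swap
  · left
    have hs := brd_upd_inr j f g v (Sum.inr v)
    refine ⟨Sum.inr v, inv_upd hI j ?_ ?_ ?_ (fun hb => hnb (hb.mono hs)) (hns.mono hs),
      fun s hc => hc.mono hs⟩
    · intro v' hv; exact hv
    · intro X hX; cases hX
    · intro i hi _ hfi; exact hI.c1 i hi v hfi
  by_cases hcopy : ∃ i, i < e + 2 ∧ i ≠ j ∧ f i = Sum.inl X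
  · obtain ⟨i, hi, hij, hfi⟩ := hcopy
    obtain ⟨v, hv⟩ := hI.c2 i hi X hfi
    have hs := (brd_upd_inl j hj f g X v).le
    rw [Set.insert_eq_of_mem (show (X, v) ∈ brdj j f g from ⟨i, hi, hij, hfi, hv⟩)] at hs
    left
    refine ⟨Sum.inr v, inv_upd hI j ?_ ?_ ?_ (fun hb => hnb (hb.mono hs)) (hns.mono hs),
      fun s hc => hc.mono hs⟩
    · intro v' hv; cases hv
    · intro X hX; exact ⟨v, rfl⟩
    · intro i' hi' _ hfi'
      rw [← hv]
      exact hI.c3 i' i hi' hi (hfi'.trans hfi.symm)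
  have hinv : ∀ v, ¬ Bad T (insert (X, v) (brdj j f g)) → Shape T (insert (X, v) (brdj j f g)) →
      Inv T (Function.update f j (Sum.inl X)) (Function.update g j (Sum.inr v)) := by
    intro v h1 h2
    rw [← brd_upd_inl j hj f g X v] at h1 h2
    refine inv_upd hI j ?_ ?_ ?_ h1 h2
    · intro v' hv; cases hv
    · intro X hX; exact ⟨v, rfl⟩
    · intro i' hi' hij hfi'
      exact absurd ⟨i', hi', hij, hfi'⟩ hcopy
  obtain ⟨hfin, hcard⟩ := brdj_fin j hj f g
  rcases ext hfin hcard hnb hns X with ⟨h1, h2⟩ | ⟨s, σ, V, h1, h2, h3⟩ | ⟨v, h1, h2, h3⟩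
  · left
    refine ⟨Sum.inr 0, hinv 0 h1 h2, fun s hc => ?_⟩
    rw [brd_upd_inl j hj] at hc
    exact contains_insert (lab_zero _ _ _ rfl) hc
  · right; left
    refine ⟨s, σ, V, X.1, X.2, h1, h2, h3, fun v hv => ?_⟩
    have := good_main h1 h2 hv
    rw [← h3] at this ⊢
    exact ⟨hinv v this.1 this.2, brd_upd_inl j hj f g X v⟩
  · right; right
    refine ⟨Sum.inr v, hinv v h1 h2, fun s hc => ?_⟩
    rw [brd_upd_inl j hj] at hc
    rw [stt_zero]
    obtain ⟨σ, q1, q2⟩ := hc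
    funext l
    obtain ⟨z, hz⟩ := h3 _ (q2 (mem_st σ l))
    have := q1 l
    dsimp at hz
    rw [hz] at this
    exact (lab_inl _ _ _ _ this).2

theorem st_inj {σ σ' : Fin (e + 1) → Qv e h × Rv w} (hs : st σ ⊆ st σ') : σ = σ' := by
  funext i
  exact (of_mem_st (hs (mem_st σ i))).symm

/-- When the board keeps a state of the second kind there is always an answer. -/
theorem answer_pos {T : Walk e (Mv h w)} {f g : ℕ → Cv e h w} (hI : Inv T f g) (j : ℕ)
    (hj : j < e + 2) (a : Cv e h w) {t c : ℕ} (ht : t < T.N) (hc : c / 2 ≠ t % 2) {σ}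
    (hL : Lab σ (stt T t c)) (hσ : st σ ⊆ brdj j f g) :
    ∃ b, Inv T (Function.update f j a) (Function.update g j b) := by
  rcases answer hI j hj a with ⟨b, h1, _⟩ | ⟨s, σ', V, i, x, h1, h2, h3, h4⟩ | ⟨b, h1, _⟩
  · exact ⟨b, h1⟩
  · rw [h3] at hσ
    obtain rfl := st_inj hσ
    obtain rfl := hL.inj h2
    obtain ⟨_, h5⟩ := h1.at ht.le
    rcases h5 with ⟨b, _⟩ | ⟨b, _, rfl, rfl, rfl⟩
    · exact absurd b hc
    · exact ⟨_, (h4 _ rfl).1⟩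
  · exact ⟨b, h1⟩

/-- The shape of the board when it contains a state of the second kind. -/
theorem pair_shape {T : Walk e (Mv h w)} {P : Set (Pr e h w)} (hS : Shape T P) {σ} {t c : ℕ}
    (hL : Lab σ (stt T t c)) (hσ : st σ ⊆ P) (ht : t < T.N) (hc4 : c < 4) (hc : c / 2 ≠ t % 2) :
    (Live P ⊆ insert (((T.gi t).succ, rvar (T.gl t) (odd c)), rval h w (T.gl t)) (st σ)) ∨
    ∃ x v c0, lab 0 x v = some c0 ∧ c0 < 4 ∧ c0 / 2 = t % 2 ∧
      Live P ⊆ insert ((0, x), v) (st σ) := by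
  obtain ⟨s1, σ1, i, x, V, v, h1, h2, h3, h4⟩ := hS
  rcases st_sub ((st_live hL hσ).trans h4) with rfl | rfl
  · left
    obtain rfl := hL.inj h3
    obtain ⟨_, h5⟩ := h1.at ht.le
    rcases h5 with ⟨b, _⟩ | ⟨b, _, rfl, rfl, rfl⟩
    · exact absurd b hc
    · subst h2
      exact h4
  · obtain ⟨t1, c1, g1, g2, rfl, g4⟩ := h1.cases'
    have hl := hL.upd_lab
    have hs := hL.inj (h3.upd hl)
    rcases g4 with ⟨b, rfl, rfl, rfl⟩ | ⟨b, ht1, rfl, rfl, rfl⟩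
    · rw [stt_upd0] at hs
      obtain ⟨rfl, -⟩ := stt_inj T ht.le g1 hs
      right
      refine ⟨(σ1 0).1, (σ1 0).2, c1, ?_, g2, b, ?_⟩
      · have := h3 0
        simpa [stt] using this
      · refine h4.trans ?_
        rintro p (rfl | ⟨i, rfl⟩)
        · right
          refine ⟨0, ?_⟩
          simp
        · by_cases hi : i = 0
          · subst hi; left; rfl
          · right
            refine ⟨i, ?_⟩
            simp [hi]
    · exfalso
      subst h2
      rw [lab_rvar _ _ _ (T.gl_lt t1 ht1)] at hl
      simp only [Option.some.injEq] at hl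
      rw [← hl, stt_updS T t1 c1 ht1] at hs
      obtain ⟨rfl, rfl⟩ := stt_inj T ht.le (by omega) hs
      omega
end

/-! ### The lower bound -/

section
variable {e h w : ℕ}

def Wt (N t c : ℕ) : ℕ := if c / 2 = t % 2 then 2 ^ (N - t) else 2 ^ (N - t - 1)

theorem Wt_ge {N t c : ℕ} : 2 ^ (N - t - 1) ≤ Wt N t c := by
  unfold Wt
  split_ifs
  · exact Nat.pow_le_pow_right (by omega) (by omega)
  · exact le_rfl

abbrev SatA (T : Walk e (Mv h w)) (f : ℕ → Cv e h w) (φ : Fml (sig e h w)) : Prop :=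
  Fml.Sat (SA T) f φ

abbrev SatB (T : Walk e (Mv h w)) (f : ℕ → Cv e h w) (φ : Fml (sig e h w)) : Prop :=
  Fml.Sat (SB T) f φ

def CP (T : Walk e (Mv h w)) (φ : Fml (sig e h w)) : Prop :=
  ∀ f g : ℕ → Cv e h w, Inv T f g → SatA T f φ → ¬ SatB T g φ → ∀ q, q ≤ 2 ^ T.N →
    (∀ t c, t ≤ T.N → c < 4 → Contains (brd f g) (stt T t c) → q ≤ Wt T.N t c) → q ≤ φ.quant

def PairP (T : Walk e (Mv h w)) (φ : Fml (sig e h w)) : Prop :=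
  ∀ (t : ℕ) (f g0 g1 : ℕ → Cv e h w) (σ : Fin (e + 1) → Qv e h × Rv w), t < T.N →
    Inv T f g0 → Inv T f g1 →
    Lab σ (stt T t (2 * ((t + 1) % 2))) → σ 0 = (yvar (odd (t + 1)), 1) →
    st σ ⊆ brd f g0 → st (Function.update σ 0 (yvar (odd (t + 1)), 2)) ⊆ brd f g1 →
    SatA T f φ → ¬ SatB T g0 φ → ¬ SatB T g1 φ → 2 ^ (T.N - t) ≤ φ.quant

theorem two_val : ((2 : Rv w)).val = 2 := by
  have : (2 : Rv w) = ⟨2, by omega⟩ := by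
    apply Fin.ext
    change 2 % (w + 3) = 2
    exact Nat.mod_eq_of_lt (by omega)
  rw [this]

theorem lab_upd2 {T : Walk e (Mv h w)} {t c : ℕ} {σ : Fin (e + 1) → Qv e h × Rv w}
    (hL : Lab σ (stt T t c)) :
    Lab (Function.update σ 0 (yvar (odd (t + 1)), 2)) (stt T t (2 * ((t + 1) % 2) + 1)) := by
  have h1 := lab_yvar (e := e) (h := h) (w := w) (odd (t + 1)) 2 (Or.inr two_val)
  rw [two_val, odd_toNat] at h1
  have := hL.upd h1
  rwa [stt_upd0] at this

theorem lab_upd1 {T : Walk e (Mv h w)} {t c : ℕ} {σ : Fin (e + 1) → Qv e h × Rv w}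
    (hL : Lab σ (stt T t c)) :
    Lab (Function.update σ 0 (yvar (odd (t + 1)), 1)) (stt T t (2 * ((t + 1) % 2))) := by
  have h1 := lab_yvar (e := e) (h := h) (w := w) (odd (t + 1)) 1 (Or.inl rfl)
  rw [odd_toNat] at h1
  have := hL.upd h1
  rwa [stt_upd0] at this

/-- The existential step of the lower bound. -/
theorem ce {T : Walk e (Mv h w)} {φ : Fml (sig e h w)} (hC : CP T φ) (hP : PairP T φ) (j : ℕ)
    (hj : j < e + 2) {f g : ℕ → Cv e h w} (hI : Inv T f g) (hA : SatA T f (.ex j φ))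
    (hB : ¬ SatB T g (.ex j φ)) (q : ℕ) (hq : q ≤ 2 ^ T.N)
    (hs : ∀ t c, t ≤ T.N → c < 4 → Contains (brdj j f g) (stt T t c) → q ≤ Wt T.N t c) :
    q ≤ φ.quant + 1 := by
  obtain ⟨a, ha⟩ := hA
  have hB' : ∀ b : Cv e h w, ¬ SatB T (Function.update g j b) φ := fun b hb => hB ⟨b, hb⟩
  rcases answer hI j hj a with ⟨b, h1, h2⟩ | ⟨s, σ, V, i, x, h1, h2, h3, h4⟩ | ⟨b, h1, h2⟩
  · refine (hC _ _ h1 ha (hB' b) q hq fun t c ht hc hcon => ?_).trans (Nat.le_succ _)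
    exact hs t c ht hc (h2 _ hcon)
  · obtain ⟨t, c, g1, g2, rfl, g4⟩ := h1.cases'
    have hW := hs t c g1 g2 ⟨σ, h2, h3.ge⟩
    rcases g4 with ⟨b, rfl, rfl, rfl⟩ | ⟨b, ht, rfl, rfl, rfl⟩
    · rw [Wt, if_pos b] at hW
      rcases g1.eq_or_lt with rfl | ht
      · simp at hW
        omega
      · refine (hW.trans ?_).trans (Nat.le_succ _)
        obtain ⟨i0, e0⟩ := h4 1 ⟨ht, Or.inl rfl⟩
        obtain ⟨i1, e1⟩ := h4 2 ⟨ht, Or.inr two_val⟩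
        refine hP t _ _ _ (Function.update σ 0 (yvar (odd (t + 1)), 1)) ht i0 i1 (lab_upd1 h2)
          (by simp) ?_ ?_ ha (hB' _) (hB' _)
        · rw [e0]
          rintro p ⟨i, rfl⟩
          by_cases hi : i = 0
          · subst hi; left; simp
          · right; exact ⟨i, by simp [hi]⟩
        · rw [e1]
          rintro p ⟨i, rfl⟩
          by_cases hi : i = 0
          · subst hi; left; simp
          · right; exact ⟨i, by simp [hi]⟩
    · rw [Wt, if_neg b] at hW
      obtain ⟨i0, e0⟩ := h4 _ rfl
      refine (hC _ _ i0 ha (hB' _) q hq fun t' c' ht' hc' hcon => ?_).trans (Nat.le_succ _)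
      rw [e0] at hcon
      rcases contains_edge h2 (fun p hp => hp.1) hcon with h5 | ⟨l, h5, h6⟩
      · obtain ⟨rfl, rfl⟩ := stt_inj T ht' g1 h5
        rw [Wt, if_neg b]; exact hW
      · rw [lab_rvar _ _ _ (T.gl_lt t ht)] at h5
        simp only [Option.some.injEq] at h5
        rw [← h5, stt_updS T t c ht] at h6
        obtain ⟨rfl, rfl⟩ := stt_inj T ht' (by omega) h6
        rw [Wt, if_pos (by omega)]
        exact hW
  · refine (hC _ _ h1 ha (hB' b) q hq fun t c ht hc hcon => ?_).trans (Nat.le_succ _)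
    obtain ⟨rfl, rfl⟩ := stt_inj T ht (by omega) (h2 _ hcon)
    rw [Wt, if_pos (by rfl)]
    exact hq

/-- All states on a board with a state of the second kind have large weight. -/
theorem pair_wt {T : Walk e (Mv h w)} {P : Set (Pr e h w)} (hS : Shape T P) {σ} {t c : ℕ}
    (hL : Lab σ (stt T t c)) (hσ : st σ ⊆ P) (ht : t < T.N) (hc4 : c < 4) (hc : c / 2 ≠ t % 2)
    {t' c' : ℕ} (ht' : t' ≤ T.N) (hcon : Contains P (stt T t' c')) :
    2 ^ (T.N - t - 1) ≤ Wt T.N t' c' := by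
  rcases pair_shape hS hL hσ ht hc4 hc with h1 | ⟨x, v, c0, h0, h2, h3, h1⟩
  · rcases contains_edge hL h1 hcon with h5 | ⟨l, h5, h6⟩
    · obtain ⟨rfl, rfl⟩ := stt_inj T ht' ht.le h5
      exact Wt_ge
    · rw [lab_rvar _ _ _ (T.gl_lt t ht)] at h5
      simp only [Option.some.injEq] at h5
      rw [← h5, stt_updS T t c ht] at h6
      obtain ⟨rfl, rfl⟩ := stt_inj T ht' (by omega) h6
      rw [Wt, if_pos (by omega)]
      exact le_of_eq (by congr 1)
  · rcases contains_edge hL h1 hcon with h5 | ⟨l, h5, h6⟩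
    · obtain ⟨rfl, rfl⟩ := stt_inj T ht' ht.le h5
      exact Wt_ge
    · rw [h0] at h5
      simp only [Option.some.injEq] at h5
      rw [← h5, stt_upd0] at h6
      obtain ⟨rfl, rfl⟩ := stt_inj T ht' ht.le h6
      exact Wt_ge

/-- The states left when one cell of a state of the second kind is removed. -/
theorem pair_lost {T : Walk e (Mv h w)} {P Q : Set (Pr e h w)} (hQP : Q ⊆ P)
    (hS : Shape T P) {σ} {t c : ℕ}
    (hL : Lab σ (stt T t c)) (hσ : st σ ⊆ P) (ht : t < T.N) (hc4 : c < 4) (hc : c / 2 ≠ t % 2)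
    {i0 : Fin (e + 1)} (hi0 : ((i0, (σ i0).1), (σ i0).2) ∉ Q)
    {t' c' : ℕ} (ht' : t' ≤ T.N) (hcon : Contains Q (stt T t' c')) :
    2 ^ (T.N - t) ≤ Wt T.N t' c' ∨ (i0 = (T.gi t).succ ∧ st (Function.update σ i0
      (rvar (T.gl t) (odd c), rval h w (T.gl t))) ⊆ Q) := by
  obtain ⟨σ', hL', hσ'⟩ := hcon
  rcases pair_shape hS hL hσ ht hc4 hc with h1 | ⟨x, v, c0, h0, h2, h3, h1⟩
  · rcases st_sub ((st_live hL' (hσ'.trans hQP)).trans h1) with rfl | rfl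
    · exact absurd (hσ' (mem_st _ _)) hi0
    · right
      have : i0 = (T.gi t).succ := by
        by_contra hne
        apply hi0
        apply hσ'
        refine ⟨i0, ?_⟩
        simp [hne]
      refine ⟨this, ?_⟩
      rw [this]
      exact hσ'
  · rcases st_sub ((st_live hL' (hσ'.trans hQP)).trans h1) with rfl | rfl
    · exact absurd (hσ' (mem_st _ _)) hi0
    · left
      have h5 := hL'.inj (hL.upd h0)
      rw [stt_upd0] at h5
      obtain ⟨rfl, rfl⟩ := stt_inj T ht' ht.le h5
      rw [Wt, if_pos h3]

theorem atom_rel {T : Walk e (Mv h w)} {f g : ℕ → Cv e h w} (hI : Inv T f g)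
    (R : Fin (e + 2) → Cv e h w) (v : Fin (e + 2) → ℕ) (hv : ∀ i, v i < e + 2)
    (hA : (fun m => f (v m)) = R ∨ rB T R (fun m => f (v m))) :
    rB T R (fun m => g (v m)) := by
  rcases hA with rfl | hA
  · constructor
    · intro i
      rcases hf : f (v i) with X | y
      · exact hI.c2 _ (hv i) X hf
      · exact ⟨y, hI.c1 _ (hv i) y hf⟩
    · intro hb
      apply hI.c4
      apply hb.mono
      rintro p ⟨i, h1, h2⟩
      exact ⟨v i, hv i, h1, h2⟩
  · have : (fun m => g (v m)) = fun m => f (v m) := by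
      funext i
      obtain ⟨y, hy⟩ := hA.1 i
      exact (hI.c1 _ (hv i) y hy).trans hy.symm
    rw [this]
    exact hA

theorem odd_two_mul (a : ℕ) : odd (2 * a) = false := by
  unfold odd; simp

theorem odd_two_mul_succ (a : ℕ) : odd (2 * a + 1) = true := by
  unfold odd; simp

theorem pair_ex {T : Walk e (Mv h w)} {φ : Fml (sig e h w)} (hC : CP T φ) (hP : PairP T φ) (j : ℕ)
    (hj : j < e + 2) : PairP T (.ex j φ) := by
  intro t f g0 g1 σ ht hI0 hI1 hL h0 hs0 hs1 hA hB0 hB1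
  have hL1 := lab_upd2 hL
  have hc0 : (2 * ((t + 1) % 2)) / 2 ≠ t % 2 := by omega
  have hc1 : (2 * ((t + 1) % 2) + 1) / 2 ≠ t % 2 := by omega
  have hx : ∀ i, ((Function.update σ 0 (yvar (odd (t + 1)), (2 : Rv w))) i).1 = (σ i).1 := by
    intro i
    by_cases hi : i = 0
    · subst hi; rw [h0]; simp
    · simp [hi]
  have hle : 2 ^ (T.N - t) ≤ 2 ^ T.N := Nat.pow_le_pow_right (by omega) (by omega)
  by_cases hall : st σ ⊆ brdj j f g0
  · have hall1 : st (Function.update σ 0 (yvar (odd (t + 1)), 2)) ⊆ brdj j f g1 := by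
      rintro p ⟨i, rfl⟩
      obtain ⟨m, m1, m2, m3, m4⟩ := hall (mem_st σ i)
      obtain ⟨m', n1, n2, n3⟩ := hs1 (mem_st _ i)
      refine ⟨m, m1, m2, ?_, ?_⟩
      · rw [m3]; simp only [hx]
      · rw [hI1.c3 m m' m1 n1, n3]
        rw [m3, n2]; simp only [hx]
    obtain ⟨a, ha⟩ := hA
    obtain ⟨b0, k0⟩ := answer_pos hI0 j hj a ht hc0 hL hall
    obtain ⟨b1, k1⟩ := answer_pos hI1 j hj a ht hc1 hL1 hall1
    refine (hP t _ _ _ σ ht k0 k1 hL h0 (hall.trans (brdj_sub_upd _ _ _ _ _))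
      (hall1.trans (brdj_sub_upd _ _ _ _ _)) ha (fun hb => hB0 ⟨b0, hb⟩)
      (fun hb => hB1 ⟨b1, hb⟩)).trans (Nat.le_succ _)
  · obtain ⟨p, ⟨i0, rfl⟩, hi0⟩ := Set.not_subset.1 hall
    dsimp only at hi0
    have hvar : ∀ m, m < e + 2 → m ≠ j → f m ≠ Sum.inl (i0, (σ i0).1) := by
      intro m hm hmj hf
      apply hi0
      obtain ⟨m', n1, n2, n3⟩ := hs0 (mem_st _ i0)
      refine ⟨m, hm, hmj, hf, ?_⟩
      rw [hI0.c3 m m' hm n1 (hf.trans n2.symm), n3]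
    have hi1 : ((i0, ((Function.update σ 0 (yvar (odd (t + 1)), (2 : Rv w))) i0).1),
        ((Function.update σ 0 (yvar (odd (t + 1)), (2 : Rv w))) i0).2) ∉ brdj j f g1 := by
      rintro ⟨m, m1, m2, m3, m4⟩
      rw [hx] at m3
      exact hvar m m1 m2 m3
    by_cases H0 : ∀ t' c', t' ≤ T.N → c' < 4 → Contains (brdj j f g0) (stt T t' c') →
        2 ^ (T.N - t) ≤ Wt T.N t' c'
    · exact ce hC hP j hj hI0 hA hB0 _ hle H0
    by_cases H1 : ∀ t' c', t' ≤ T.N → c' < 4 → Contains (brdj j f g1) (stt T t' c') →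
        2 ^ (T.N - t) ≤ Wt T.N t' c'
    · exact ce hC hP j hj hI1 hA hB1 _ hle H1
    exfalso
    push Not at H0 H1
    obtain ⟨t', c', u1, -, u3, u4⟩ := H0
    obtain ⟨t2, c2, v1, -, v3, v4⟩ := H1
    rcases pair_lost (brdj_sub j f g0) hI0.c5 hL hs0 ht (by omega) hc0 hi0 u1 u3 with h5 | ⟨-, h5⟩
    · omega
    rcases pair_lost (brdj_sub j f g1) hI1.c5 hL1 hs1 ht (by omega) hc1 hi1 v1 v3 with
      h6 | ⟨-, h6⟩
    · omega
    rw [odd_two_mul] at h5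
    rw [odd_two_mul_succ] at h6
    obtain ⟨hfin, hcard⟩ := brdj_fin j hj f g0
    have heq := Set.eq_of_subset_of_ncard_le h5 (by rw [st_ncard]; exact hcard) hfin
    obtain ⟨m, m1, m2, m3, m4⟩ := h6 (mem_st _ i0)
    rw [Function.update_self] at m3
    obtain ⟨v, hv⟩ := hI0.c2 m m1 _ m3
    have hmem : ((i0, (rvar (T.gl t) true : Qv e h)), v) ∈ brdj j f g0 := ⟨m, m1, m2, m3, hv⟩
    rw [← heq] at hmem
    have := of_mem_st hmem
    rw [Function.update_self] at this
    simp only [Prod.mk.injEq] at this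
    exact rvar_ne _ this.1.symm

theorem lower {T : Walk e (Mv h w)} (φ : Fml (sig e h w)) (hE : φ.ExPos) (hU : UsesVars (e + 2) φ) :
    CP T φ ∧ PairP T φ := by
  induction φ with
  | eq i j =>
    have key : ∀ f g : ℕ → Cv e h w, Inv T f g → SatA T f (.eq i j) → SatB T g (.eq i j) := by
      intro f g hI hA
      exact hI.c3 i j (hU i (by simp [Fml.vars])) (hU j (by simp [Fml.vars])) hA
    exact ⟨fun f g hI hA hB => absurd (key f g hI hA) hB,
      fun t f g0 g1 σ _ hI0 _ _ _ _ _ hA hB _ => absurd (key f g0 hI0 hA) hB⟩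
  | rel R v =>
    have key : ∀ f g : ℕ → Cv e h w, Inv T f g → SatA T f (.rel R v) → SatB T g (.rel R v) := by
      intro f g hI hA
      exact atom_rel hI R v (fun i => hU _ (by
        simp only [Fml.vars]; exact Finset.mem_image_of_mem _ (Finset.mem_univ i))) hA
    exact ⟨fun f g hI hA hB => absurd (key f g hI hA) hB,
      fun t f g0 g1 σ _ hI0 _ _ _ _ _ hA hB _ => absurd (key f g0 hI0 hA) hB⟩
  | not φ _ => exact absurd hE (by simp [Fml.ExPos])
  | all i φ _ => exact absurd hE (by simp [Fml.ExPos])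
  | and φ ψ ih1 ih2 =>
    obtain ⟨c1, p1⟩ := ih1 hE.1 (fun i hi => hU i (by simp [Fml.vars, hi]))
    obtain ⟨c2, p2⟩ := ih2 hE.2 (fun i hi => hU i (by simp [Fml.vars, hi]))
    constructor
    · intro f g hI hA hB q hq hs
      simp only [Fml.quant]
      by_cases hb : SatB T g φ
      · have := c2 f g hI hA.2 (fun hb' => hB ⟨hb, hb'⟩) q hq hs
        omega
      · have := c1 f g hI hA.1 hb q hq hs
        omega
    · intro t f g0 g1 σ ht hI0 hI1 hL h0 hs0 hs1 hA hB0 hB1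
      simp only [Fml.quant]
      have hle : 2 ^ (T.N - t - 1) ≤ 2 ^ T.N := Nat.pow_le_pow_right (by omega) (by omega)
      have hsum : 2 ^ (T.N - t) = 2 ^ (T.N - t - 1) + 2 ^ (T.N - t - 1) := by
        have : T.N - t = (T.N - t - 1) + 1 := by omega
        rw [this, pow_succ]; simp; omega
      have w0 : ∀ t' c', t' ≤ T.N → c' < 4 → Contains (brd f g0) (stt T t' c') →
          2 ^ (T.N - t - 1) ≤ Wt T.N t' c' := fun t' c' ht' _ hc =>
        pair_wt hI0.c5 hL hs0 ht (by omega) (by omega) ht' hc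
      have w1 : ∀ t' c', t' ≤ T.N → c' < 4 → Contains (brd f g1) (stt T t' c') →
          2 ^ (T.N - t - 1) ≤ Wt T.N t' c' := fun t' c' ht' _ hc =>
        pair_wt hI1.c5 (lab_upd2 hL) hs1 ht (by omega) (by omega) ht' hc
      by_cases b0 : SatB T g0 φ
      · have b0' : ¬ SatB T g0 ψ := fun hb' => hB0 ⟨b0, hb'⟩
        by_cases b1 : SatB T g1 ψ
        · have b1' : ¬ SatB T g1 φ := fun hb' => hB1 ⟨hb', b1⟩
          have q1 := c2 f g0 hI0 hA.2 b0' _ hle w0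
          have q2 := c1 f g1 hI1 hA.1 b1' _ hle w1
          omega
        · have := p2 t f g0 g1 σ ht hI0 hI1 hL h0 hs0 hs1 hA.2 b0' b1
          omega
      · by_cases b1 : SatB T g1 φ
        · have b1' : ¬ SatB T g1 ψ := fun hb' => hB1 ⟨b1, hb'⟩
          have q1 := c1 f g0 hI0 hA.1 b0 _ hle w0
          have q2 := c2 f g1 hI1 hA.2 b1' _ hle w1
          omega
        · have := p1 t f g0 g1 σ ht hI0 hI1 hL h0 hs0 hs1 hA.1 b0 b1
          omega
  | or φ ψ ih1 ih2 =>
    obtain ⟨c1, p1⟩ := ih1 hE.1 (fun i hi => hU i (by simp [Fml.vars, hi]))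
    obtain ⟨c2, p2⟩ := ih2 hE.2 (fun i hi => hU i (by simp [Fml.vars, hi]))
    constructor
    · intro f g hI hA hB q hq hs
      simp only [Fml.quant]
      rcases hA with hA | hA
      · have := c1 f g hI hA (fun hb => hB (Or.inl hb)) q hq hs
        omega
      · have := c2 f g hI hA (fun hb => hB (Or.inr hb)) q hq hs
        omega
    · intro t f g0 g1 σ ht hI0 hI1 hL h0 hs0 hs1 hA hB0 hB1
      simp only [Fml.quant]
      rcases hA with hA | hA
      · have := p1 t f g0 g1 σ ht hI0 hI1 hL h0 hs0 hs1 hA (fun hb => hB0 (Or.inl hb))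
          (fun hb => hB1 (Or.inl hb))
        omega
      · have := p2 t f g0 g1 σ ht hI0 hI1 hL h0 hs0 hs1 hA (fun hb => hB0 (Or.inr hb))
          (fun hb => hB1 (Or.inr hb))
        omega
  | ex j φ ih =>
    obtain ⟨c1, p1⟩ := ih hE (fun i hi => hU i (by simp [Fml.vars, hi]))
    have hj : j < e + 2 := hU j (by simp [Fml.vars])
    refine ⟨?_, pair_ex c1 p1 j hj⟩
    intro f g hI hA hB q hq hs
    exact ce c1 p1 j hj hI hA hB q hq fun t c ht hc hcon =>
      hs t c ht hc (hcon.mono (brdj_sub j f g))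

theorem inv_start (T : Walk e (Mv h w)) : Inv T (fun _ => Sum.inr 0) (fun _ => Sum.inr 0) := by
  have hemp : brd (fun _ => (Sum.inr 0 : Cv e h w)) (fun _ => Sum.inr 0) = ∅ := by
    ext p
    simp [brd]
  refine ⟨fun i _ v hv => hv, fun i _ X hX => by simp at hX, fun _ _ _ _ _ => rfl, ?_, ?_⟩
  · rw [hemp]
    rintro (⟨s, i, x, V, v, h1, h2, h3, h4⟩ | ⟨m, h1, h2⟩)
    · exact h4
    · obtain ⟨v, _, hp⟩ := h2 0 (by have := m.2; simp; omega)
      exact hp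
  · rw [hemp]
    obtain ⟨V, hV, v, hv⟩ := Rule.zero (T := T)
    refine ⟨_, fun l => (Sum.inl 0, 1), _, _, V, v, hV, hv, ?_, ?_⟩
    · intro l
      exact lab_inl_one _ _ _ rfl
    · rintro p ⟨hp, -⟩
      exact absurd hp (by simp)

theorem sat_free {σ : Signature} (M : Struct σ) (φ : Fml σ) :
    ∀ f g : ℕ → M.carrier, (∀ i ∈ φ.freeVars, f i = g i) → Fml.Sat M f φ → Fml.Sat M g φ := by
  have sym : ∀ (φ : Fml σ) (f g : ℕ → M.carrier), (∀ i ∈ φ.freeVars, f i = g i) →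
      (Fml.Sat M f φ ↔ Fml.Sat M g φ) := by
    intro φ
    induction φ with
    | eq i j =>
      intro f g hfg
      simp only [Fml.Sat]
      rw [hfg i (by simp [Fml.freeVars]), hfg j (by simp [Fml.freeVars])]
    | rel R v =>
      intro f g hfg
      simp only [Fml.Sat]
      have : (fun m => f (v m)) = fun m => g (v m) := by
        funext m
        exact hfg _ (by simp [Fml.freeVars])
      rw [this]
    | not φ ih => intro f g hfg; exact not_congr (ih f g hfg)
    | and φ ψ ih1 ih2 =>
      intro f g hfg
      exact and_congr (ih1 f g fun i hi => hfg i (by simp [Fml.freeVars, hi]))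
        (ih2 f g fun i hi => hfg i (by simp [Fml.freeVars, hi]))
    | or φ ψ ih1 ih2 =>
      intro f g hfg
      exact or_congr (ih1 f g fun i hi => hfg i (by simp [Fml.freeVars, hi]))
        (ih2 f g fun i hi => hfg i (by simp [Fml.freeVars, hi]))
    | ex j φ ih =>
      intro f g hfg
      refine exists_congr fun a => ih _ _ fun i hi => ?_
      by_cases hij : i = j
      · subst hij; simp
      · simp [hij, hfg i (by simp [Fml.freeVars, hi, hij])]
    | all j φ ih =>
      intro f g hfg
      refine forall_congr' fun a => ih _ _ fun i hi => ?_
      by_cases hij : i = j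
      · subst hij; simp
      · simp [hij, hfg i (by simp [Fml.freeVars, hi, hij])]
  intro f g hfg
  exact (sym φ f g hfg).1

theorem sat_mono (T : Walk e (Mv h w)) (φ : Fml (sig e h w)) (hE : φ.ExPos) :
    ∀ f : ℕ → Cv e h w, SatB T f φ → SatA T f φ := by
  induction φ with
  | eq i j => intro f hf; exact hf
  | rel R v => intro f hf; exact Or.inr hf
  | not φ _ => exact absurd hE (by simp [Fml.ExPos])
  | all i φ _ => exact absurd hE (by simp [Fml.ExPos])
  | and φ ψ ih1 ih2 => intro f hf; exact ⟨ih1 hE.1 f hf.1, ih2 hE.2 f hf.2⟩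
  | or φ ψ ih1 ih2 => intro f hf; exact hf.imp (ih1 hE.1 f) (ih2 hE.2 f)
  | ex j φ ih =>
    intro f hf
    obtain ⟨a, ha⟩ := hf
    exact ⟨a, ih hE _ ha⟩

theorem agree (T : Walk e (Mv h w)) (φ : Fml (sig e h w)) (hU : UsesVars (e + 2) φ) (hE : φ.ExPos)
    (hS : IsSentence φ) (hq : φ.quant < 2 ^ T.N) : AgreeOn (SA T) (SB T) φ := by
  constructor
  · intro hA f
    by_contra hB
    have hB' : ¬ SatB T (fun _ => Sum.inr 0) φ := by
      intro hb
      apply hB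
      refine sat_free _ φ _ f ?_ hb
      intro i hi
      unfold IsSentence at hS
      rw [hS] at hi
      simp at hi
    have := (lower φ hE hU).1 _ _ (inv_start T) (hA _) hB' (2 ^ T.N) le_rfl ?_
    · omega
    · rintro t c _ _ ⟨σ, _, hσ⟩
      obtain ⟨i, _, h1, _⟩ := hσ (mem_st σ 0)
      simp at h1
  · intro hB f
    exact sat_mono T φ hE f (hB f)
end

/-! ### The distinguishing sentence -/

section
variable {e h w : ℕ}

def conj {σ : Signature} (b : Fml σ) : List (Fml σ) → Fml σ
  | [] => b
  | φ :: l => .and φ (conj b l)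

theorem conj_sat {σ : Signature} (M : Struct σ) (f : ℕ → M.carrier) (b : Fml σ)
    (l : List (Fml σ)) :
    Fml.Sat M f (conj b l) ↔ Fml.Sat M f b ∧ ∀ φ ∈ l, Fml.Sat M f φ := by
  induction l with
  | nil => simp [conj]
  | cons φ l ih => simp only [conj, Fml.Sat, ih, List.forall_mem_cons]; tauto

theorem conj_exPos {σ : Signature} (b : Fml σ) (l : List (Fml σ)) (hb : b.ExPos)
    (hl : ∀ φ ∈ l, Fml.ExPos φ) : (conj b l).ExPos := by
  induction l with
  | nil => exact hb
  | cons φ l ih =>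
    exact ⟨hl φ (by simp), ih fun ψ hψ => hl ψ (by simp [hψ])⟩

theorem conj_uses {σ : Signature} {k : ℕ} (b : Fml σ) (l : List (Fml σ)) (hb : UsesVars k b)
    (hl : ∀ φ ∈ l, UsesVars k φ) : UsesVars k (conj b l) := by
  induction l with
  | nil => exact hb
  | cons φ l ih =>
    intro i hi
    simp only [conj, Fml.vars, Finset.mem_union] at hi
    rcases hi with hi | hi
    · exact hl φ (by simp) i hi
    · exact ih (fun ψ hψ => hl ψ (by simp [hψ])) i hi

theorem free_sub {σ : Signature} (φ : Fml σ) : φ.freeVars ⊆ φ.vars := by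
  induction φ with
  | eq i j => exact subset_rfl
  | rel R v => exact subset_rfl
  | not φ ih => exact ih
  | and φ ψ h1 h2 => exact Finset.union_subset_union h1 h2
  | or φ ψ h1 h2 => exact Finset.union_subset_union h1 h2
  | ex i φ ih => exact ((Finset.erase_subset _ _).trans ih).trans (Finset.subset_insert _ _)
  | all i φ ih => exact ((Finset.erase_subset _ _).trans ih).trans (Finset.subset_insert _ _)

def exB {σ : Signature} : List ℕ → Fml σ → Fml σ
  | [], φ => φ
  | j :: l, φ => .ex j (exB l φ)

theorem exB_exPos {σ : Signature} (l : List ℕ) (φ : Fml σ) (hE : φ.ExPos) : (exB l φ).ExPos := by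
  induction l with
  | nil => exact hE
  | cons j l ih => exact ih

theorem exB_uses {σ : Signature} {k : ℕ} (l : List ℕ) (φ : Fml σ) (hU : UsesVars k φ)
    (hl : ∀ j ∈ l, j < k) : UsesVars k (exB l φ) := by
  induction l with
  | nil => exact hU
  | cons j l ih =>
    intro i hi
    simp only [exB, Fml.vars, Finset.mem_insert] at hi
    rcases hi with rfl | hi
    · exact hl _ (by simp)
    · exact ih (fun ψ hψ => hl ψ (by simp [hψ])) i hi

theorem exB_free {σ : Signature} (l : List ℕ) (φ : Fml σ) {n : ℕ} (hn : n ∈ (exB l φ).freeVars) :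
    n ∈ φ.freeVars ∧ n ∉ l := by
  induction l with
  | nil => exact ⟨hn, by simp⟩
  | cons j l ih =>
    simp only [exB, Fml.freeVars, Finset.mem_erase] at hn
    obtain ⟨h1, h2⟩ := ih hn.2
    refine ⟨h1, ?_⟩
    simp only [List.mem_cons, not_or]
    exact ⟨hn.1, h2⟩

theorem exB_intro {σ : Signature} (M : Struct σ) (l : List ℕ) (φ : Fml σ) :
    ∀ f f' : ℕ → M.carrier, (∀ n, n ∉ l → f' n = f n) → Fml.Sat M f' φ →
      Fml.Sat M f (exB l φ) := by
  induction l with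
  | nil =>
    intro f f' hf hs
    have : f' = f := funext fun n => hf n (by simp)
    subst this
    exact hs
  | cons j l ih =>
    intro f f' hf hs
    refine ⟨f' j, ih _ f' ?_ hs⟩
    intro n hn
    by_cases hnj : n = j
    · subst hnj; simp
    · rw [Function.update_of_ne hnj]
      exact hf n (by simp [hnj, hn])

theorem exB_elim {σ : Signature} (M : Struct σ) (l : List ℕ) (φ : Fml σ) :
    ∀ f : ℕ → M.carrier, Fml.Sat M f (exB l φ) →
      ∃ f' : ℕ → M.carrier, (∀ n, n ∉ l → f' n = f n) ∧ Fml.Sat M f' φ := by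
  induction l with
  | nil => intro f hs; exact ⟨f, fun _ _ => rfl, hs⟩
  | cons j l ih =>
    intro f hs
    obtain ⟨a, ha⟩ := hs
    obtain ⟨f', h1, h2⟩ := ih _ ha
    refine ⟨f', fun n hn => ?_, h2⟩
    simp only [List.mem_cons, not_or] at hn
    rw [h1 n hn.2, Function.update_of_ne hn.1]

/-- The atom describing a full placement. -/
def chi (F : ℕ → Cv e h w) : Fml (sig e h w) :=
  .rel (σ := sig e h w) (fun i : Fin (e + 2) => F i.val) (fun i : Fin (e + 2) => i.val)

theorem chi_uses (F : ℕ → Cv e h w) : UsesVars (e + 2) (chi F) := by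
  intro i hi
  simp only [chi, Fml.vars] at hi
  obtain ⟨m, _, rfl⟩ := Finset.mem_image.1 hi
  exact Fin.is_lt (n := e + 2) m

theorem chi_A (T : Walk e (Mv h w)) (F f : ℕ → Cv e h w) (hf : ∀ n, n < e + 2 → f n = F n) :
    SatA T f (chi F) :=
  Or.inl (funext fun i : Fin (e + 2) => hf i.val i.2)

theorem chi_B (T : Walk e (Mv h w)) (F g : ℕ → Cv e h w) (hg : SatB T g (chi F)) :
    (∀ n, n < e + 2 → ∃ v, g n = Sum.inr v) ∧ ¬ Bad T (brd F g) := by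
  obtain ⟨h1, h2⟩ := hg
  refine ⟨fun n hn => h1 ⟨n, hn⟩, fun hb => h2 (hb.mono ?_)⟩
  rintro p ⟨i, hi, h3⟩
  exact ⟨⟨i, hi⟩, h3⟩

def Dst (T : Walk e (Mv h w)) (σ : Fin (e + 1) → Qv e h × Rv w) : Prop :=
  ∀ π : Fin (e + 1) → ℕ, Function.Injective π → (∀ i, π i < e + 2) →
    ∃ φ : Fml (sig e h w), φ.ExPos ∧ UsesVars (e + 2) φ ∧
      (∀ f : ℕ → Cv e h w, (∀ i, f (π i) = Sum.inl (i, (σ i).1)) → SatA T f φ) ∧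
      (∀ g : ℕ → Cv e h w, (∀ i, g (π i) = Sum.inr (σ i).2) → ¬ SatB T g φ)

theorem Dst_step {T : Walk e (Mv h w)} {s σ i x V} (hr : Rule T s i x V) (hL : Lab σ s)
    (hV : ∀ v, V v → Dst T (Function.update σ i (x, v))) : Dst T σ := by
  classical
  intro π hπ hlt
  -- the spare variable
  have hcard : (Finset.univ.image π).card = e + 1 := by
    rw [Finset.card_image_of_injective _ hπ]; simp
  have hsub : Finset.univ.image π ⊆ Finset.range (e + 2) := by
    intro n hn
    obtain ⟨i, _, rfl⟩ := Finset.mem_image.1 hn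
    simpa using hlt i
  have hc2 : (Finset.range (e + 2) \ Finset.univ.image π).card = 1 := by
    rw [Finset.card_sdiff_of_subset hsub, hcard]; simp
  obtain ⟨j, hj⟩ := Finset.card_eq_one.1 hc2
  have hj' : j ∈ Finset.range (e + 2) \ Finset.univ.image π := by rw [hj]; simp
  simp only [Finset.mem_sdiff, Finset.mem_range, Finset.mem_image, Finset.mem_univ, true_and,
    not_exists] at hj'
  obtain ⟨hjk, hjπ⟩ := hj'
  have hcov : ∀ n, n < e + 2 → n = j ∨ ∃ i, π i = n := by
    intro n hn
    by_cases hex : ∃ i, π i = n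
    · exact Or.inr hex
    · left
      have : n ∈ Finset.range (e + 2) \ Finset.univ.image π := by
        simp only [Finset.mem_sdiff, Finset.mem_range, Finset.mem_image, Finset.mem_univ,
          true_and]
        exact ⟨hn, hex⟩
      rw [hj] at this
      simpa using this
  have hπ' : Function.Injective (Function.update π i j) := by
    intro a b hab
    by_cases ha : a = i
    · by_cases hb : b = i
      · rw [ha, hb]
      · subst ha
        rw [Function.update_self, Function.update_of_ne hb] at hab
        exact absurd hab.symm (hjπ b)
    · by_cases hb : b = i
      · subst hb
        rw [Function.update_self, Function.update_of_ne ha] at hab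
        exact absurd hab (hjπ a)
      · rw [Function.update_of_ne ha, Function.update_of_ne hb] at hab
        exact hπ hab
  have hlt' : ∀ a, Function.update π i j a < e + 2 := by
    intro a
    by_cases ha : a = i
    · subst ha; simpa using hjk
    · simpa [ha] using hlt a
  have hex : ∀ v, ∃ φ : Fml (sig e h w), V v → φ.ExPos ∧ UsesVars (e + 2) φ ∧
      (∀ f : ℕ → Cv e h w, (∀ i', f (Function.update π i j i') =
        Sum.inl (i', (Function.update σ i (x, v) i').1)) → SatA T f φ) ∧
      (∀ g : ℕ → Cv e h w, (∀ i', g (Function.update π i j i') =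
        Sum.inr (Function.update σ i (x, v) i').2) → ¬ SatB T g φ) := by
    intro v
    by_cases hv : V v
    · obtain ⟨φ, hφ⟩ := hV v hv _ hπ' hlt'
      exact ⟨φ, fun _ => hφ⟩
    · exact ⟨.eq 0 0, fun h => absurd h hv⟩
  choose Φ hΦ using hex
  let f0 : ℕ → Cv e h w :=
    Function.extend π (fun i' => Sum.inl (i', (σ i').1)) (fun _ => Sum.inl (i, x))
  have hf0 : ∀ i', f0 (π i') = Sum.inl (i', (σ i').1) := fun i' => hπ.extend_apply _ _ _
  have hf0j : f0 j = Sum.inl (i, x) :=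
    Function.extend_apply' _ _ _ (by rintro ⟨a, ha⟩; exact hjπ a ha)
  let L : List (Fml (sig e h w)) := ((Finset.univ.filter V).toList).map Φ
  have hmemL : ∀ φ, φ ∈ L ↔ ∃ v, V v ∧ Φ v = φ := by
    intro φ
    simp [L]
  refine ⟨.ex j (conj (chi f0) L), ?_, ?_, ?_, ?_⟩
  · apply conj_exPos (chi f0) L trivial
    intro φ hφ
    obtain ⟨v, hv, rfl⟩ := (hmemL φ).1 hφ
    exact (hΦ v hv).1
  · intro n hn
    simp only [Fml.vars, Finset.mem_insert] at hn
    rcases hn with rfl | hn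
    · exact hjk
    · refine conj_uses _ _ (chi_uses f0) ?_ n hn
      intro φ hφ
      obtain ⟨v, hv, rfl⟩ := (hmemL φ).1 hφ
      exact (hΦ v hv).2.1
  · intro f hf
    refine ⟨(Sum.inl (i, x) : Cv e h w), ?_⟩
    rw [conj_sat]
    constructor
    · apply chi_A
      intro n hn
      rcases hcov n hn with rfl | ⟨i', rfl⟩
      · rw [hf0j]; exact Function.update_self _ _ _
      · rw [hf0, ← hf]; exact Function.update_of_ne (hjπ i') _ _
    · intro φ hφ
      obtain ⟨v, hv, rfl⟩ := (hmemL φ).1 hφ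
      apply (hΦ v hv).2.2.1
      intro i'
      by_cases hi : i' = i
      · subst hi
        rw [Function.update_self, Function.update_self]
        exact Function.update_self _ _ _
      · rw [Function.update_of_ne hi, Function.update_of_ne hi, ← hf]
        exact Function.update_of_ne (hjπ i') _ _
  · rintro g hg ⟨b, hb⟩
    rw [conj_sat] at hb
    obtain ⟨hb1, hb2⟩ := hb
    obtain ⟨h1, h2⟩ := chi_B T f0 _ hb1
    obtain ⟨v, hv⟩ := h1 j hjk
    have hbv : b = Sum.inr v := by
      rw [← hv]; exact (Function.update_self j b g).symm
    subst hbv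
    have hmem : ((i, x), v) ∈ brd f0 (Function.update g j (Sum.inr v)) :=
      ⟨j, hjk, hf0j, Function.update_self _ _ _⟩
    by_cases hVv : V v
    · apply (hΦ v hVv).2.2.2 _ _ (hb2 _ ((hmemL _).2 ⟨v, hVv, rfl⟩))
      intro i'
      by_cases hi : i' = i
      · subst hi
        rw [Function.update_self, Function.update_self]
        exact Function.update_self _ _ _
      · rw [Function.update_of_ne hi, Function.update_of_ne hi, ← hg]
        exact Function.update_of_ne (hjπ i') _ _
    · apply h2
      refine Or.inl ⟨s, i, x, V, v, hr, ⟨σ, hL, ?_⟩, hVv, hmem⟩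
      rintro p ⟨i', rfl⟩
      refine ⟨π i', hlt i', hf0 i', ?_⟩
      refine Eq.trans ?_ (hg i')
      exact Function.update_of_ne (hjπ i') _ _

theorem Dst_main (T : Walk e (Mv h w)) : ∀ d t : ℕ, t ≤ T.N → T.N - t = d → ∀ c, c < 4 →
    (t < T.N ∨ c / 2 = t % 2) → ∀ σ, Lab σ (stt T t c) → Dst T σ := by
  intro d
  induction d with
  | zero =>
    intro t ht hd c hc hor σ hL
    have hc2 : c / 2 = t % 2 := by
      rcases hor with h1 | h1
      · omega
      · exact h1
    refine Dst_step (Rule.br t c ht hc hc2) hL ?_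
    rintro v ⟨h1, _⟩
    omega
  | succ d ih =>
    intro t ht hd
    have htN : t < T.N := by omega
    have hY : ∀ c, c < 4 → c / 2 ≠ t % 2 → ∀ σ, Lab σ (stt T t c) → Dst T σ := by
      intro c hc hc2 σ hL
      refine Dst_step (Rule.mv t c htN hc hc2) hL ?_
      rintro v rfl
      have := hL.upd (lab_rvar (T.gi t) (T.gl t) (odd c) (T.gl_lt t htN))
      rw [stt_updS T t c htN] at this
      exact ih (t + 1) (by omega) (by omega) c hc (Or.inr (by omega)) _ this
    intro c hc _ σ hL
    by_cases hc2 : c / 2 = t % 2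
    · refine Dst_step (Rule.br t c ht hc hc2) hL ?_
      rintro v ⟨_, hv⟩
      have := hL.upd (lab_yvar (e := e) (h := h) (odd (t + 1)) v hv)
      rw [stt_upd0, odd_toNat] at this
      refine hY _ ?_ ?_ _ this
      · rcases hv with hv | hv <;> rw [hv] <;> omega
      · rcases hv with hv | hv <;> rw [hv] <;> omega
    · exact hY c hc hc2 σ hL

def Dm (T : Walk e (Mv h w)) (m : ℕ) : Prop :=
  ∀ (xs : Fin (e + 1) → Fin (e + 2)) (π : Fin (e + 1) → ℕ),
    (∀ l l', l.val < m → l'.val < m → π l = π l' → l = l') → (∀ l, l.val < m → π l < e + 2) →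
    ∃ φ : Fml (sig e h w), φ.ExPos ∧ UsesVars (e + 2) φ ∧
      (∀ f : ℕ → Cv e h w, (∀ l, l.val < m → f (π l) = Sum.inl (l, Sum.inl (xs l))) →
        SatA T f φ) ∧
      (∀ g : ℕ → Cv e h w, (∀ l, l.val < m → g (π l) = Sum.inr 1) → ¬ SatB T g φ)

theorem Dm_top (T : Walk e (Mv h w)) : Dm T (e + 1) := by
  intro xs π hinj hlt
  have hD : Dst T (fun l => ((Sum.inl (xs l) : Qv e h), (1 : Rv w))) := by
    apply Dst_main T _ 0 (by omega) rfl 0 (by omega) (Or.inl T.hN)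
    rw [stt_zero]
    intro l
    exact lab_inl_one _ _ _ rfl
  obtain ⟨φ, h1, h2, h3, h4⟩ := hD π (fun a b hab => hinj a b a.2 b.2 hab) (fun i => hlt i i.2)
  exact ⟨φ, h1, h2, fun f hf => h3 f fun i => hf i i.2, fun g hg => h4 g fun i => hg i i.2⟩

theorem Dm_step (T : Walk e (Mv h w)) (m : ℕ) (hm : m < e + 1) (hD : Dm T (m + 1))
    (xs : Fin (e + 1) → Fin (e + 2)) (π : Fin (e + 1) → ℕ)
    (hinj : ∀ l l', l.val < m → l'.val < m → π l = π l' → l = l')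
    (hlt : ∀ l, l.val < m → π l < e + 2) :
    ∃ φ : Fml (sig e h w), φ.ExPos ∧ UsesVars (e + 2) φ ∧
      (∀ f : ℕ → Cv e h w, (∀ l, l.val < m → f (π l) = Sum.inl (l, Sum.inl (xs l))) →
        SatA T f φ) ∧
      (∀ g : ℕ → Cv e h w, (∀ l, l.val < m → g (π l) = Sum.inr 1) → ¬ SatB T g φ) ∧
      (∀ n ∈ φ.freeVars, ∃ l, l.val < m ∧ π l = n) := by
  classical
  let mm : Fin (e + 1) := ⟨m, hm⟩
  let I : Finset ℕ := (Finset.univ.filter fun l : Fin (e + 1) => l.val < m).image π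
  have hI : ∀ n, n ∈ I ↔ ∃ l : Fin (e + 1), l.val < m ∧ π l = n := by
    intro n; simp [I]
  have hcardI : I.card = m := by
    rw [Finset.card_image_of_injOn, Fin.card_filter_val_lt]
    · omega
    · intro a ha b hb hab
      exact hinj a b (by simpa using ha) (by simpa using hb) hab
  let R : Finset ℕ := Finset.range (e + 2) \ I
  have hR : ∀ n, n ∈ R ↔ n < e + 2 ∧ n ∉ I := by
    intro n; simp [R]
  have hcardR : R.card = e + 2 - m := by
    rw [Finset.card_sdiff_of_subset, hcardI]
    · simp
    · intro n hn
      obtain ⟨l, hl, rfl⟩ := (hI n).1 hn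
      simpa using hlt l hl
  let E := R.equivFinOfCardEq hcardR
  let y : ℕ → Fin (e + 2) := fun n =>
    if hn : n ∈ R then Fin.castLE (by omega) (E ⟨n, hn⟩) else 0
  have hy : ∀ z : Fin (e + 2), z.val < e + 2 - m → ∃ n ∈ R, y n = z := by
    intro z hz
    refine ⟨(E.symm ⟨z.val, hz⟩).1, (E.symm ⟨z.val, hz⟩).2, ?_⟩
    simp [y]
  have hex0 : ∃ f0 : ℕ → Cv e h w, (∀ l, l.val < m → f0 (π l) = Sum.inl (l, Sum.inl (xs l))) ∧
      ∀ n ∈ R, f0 n = Sum.inl (mm, Sum.inl (y n)) := by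
    refine ⟨fun n => if hn : ∃ l : Fin (e + 1), l.val < m ∧ π l = n then
      Sum.inl (hn.choose, Sum.inl (xs hn.choose)) else Sum.inl (mm, Sum.inl (y n)), ?_, ?_⟩
    · intro l hl
      have hn : ∃ l' : Fin (e + 1), l'.val < m ∧ π l' = π l := ⟨l, hl, rfl⟩
      have := hinj _ _ hn.choose_spec.1 hl hn.choose_spec.2
      simp only [hn, dite_true]
      rw [this]
    · intro n hn
      have := ((hR n).1 hn).2
      rw [hI] at this
      simp only [this, dite_false]
  obtain ⟨f0, hf1, hf2⟩ := hex0
  have hex : ∀ r, ∃ φ : Fml (sig e h w), r ∈ R → φ.ExPos ∧ UsesVars (e + 2) φ ∧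
      (∀ f : ℕ → Cv e h w, (∀ l, l.val < m + 1 → f (Function.update π mm r l) =
        Sum.inl (l, Sum.inl (Function.update xs mm (y r) l))) → SatA T f φ) ∧
      (∀ g : ℕ → Cv e h w, (∀ l, l.val < m + 1 → g (Function.update π mm r l) = Sum.inr 1) →
        ¬ SatB T g φ) := by
    intro r
    by_cases hr : r ∈ R
    · obtain ⟨hr1, hr2⟩ := (hR r).1 hr
      rw [hI] at hr2
      push Not at hr2
      obtain ⟨φ, hφ⟩ := hD (Function.update xs mm (y r)) (Function.update π mm r) (by
          intro a b ha hb hab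
          by_cases ha' : a = mm
          · by_cases hb' : b = mm
            · rw [ha', hb']
            · have hb2 : b.val < m := by
                have : b.val ≠ m := fun hh => hb' (Fin.ext hh)
                omega
              subst ha'
              rw [Function.update_self, Function.update_of_ne hb'] at hab
              exact absurd hab.symm (hr2 b hb2)
          · have ha2 : a.val < m := by
              have : a.val ≠ m := fun hh => ha' (Fin.ext hh)
              omega
            by_cases hb' : b = mm
            · subst hb'
              rw [Function.update_self, Function.update_of_ne ha'] at hab
              exact absurd hab (hr2 a ha2)
            · have hb2 : b.val < m := by
                have : b.val ≠ m := fun hh => hb' (Fin.ext hh)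
                omega
              rw [Function.update_of_ne ha', Function.update_of_ne hb'] at hab
              exact hinj a b ha2 hb2 hab) (by
          intro a ha
          by_cases ha' : a = mm
          · subst ha'; simpa using hr1
          · have ha2 : a.val < m := by
              have : a.val ≠ m := fun hh => ha' (Fin.ext hh)
              omega
            simpa [ha'] using hlt a ha2)
      exact ⟨φ, fun _ => hφ⟩
    · exact ⟨.eq 0 0, fun h => absurd h hr⟩
  choose Φ hΦ using hex
  let L : List (Fml (sig e h w)) := (R.toList).map Φ
  have hmemL : ∀ φ, φ ∈ L ↔ ∃ r, r ∈ R ∧ Φ r = φ := by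
    intro φ
    simp [L]
  have hU : UsesVars (e + 2) (exB R.toList (conj (chi f0) L)) := by
    apply exB_uses
    · apply conj_uses _ _ (chi_uses f0)
      intro φ hφ
      obtain ⟨v, hv, rfl⟩ := (hmemL φ).1 hφ
      exact (hΦ v hv).2.1
    · intro n hn
      exact ((hR n).1 (by simpa using hn)).1
  refine ⟨exB R.toList (conj (chi f0) L), ?_, hU, ?_, ?_, ?_⟩
  · apply exB_exPos
    apply conj_exPos (chi f0) L trivial
    intro φ hφ
    obtain ⟨v, hv, rfl⟩ := (hmemL φ).1 hφ
    exact (hΦ v hv).1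
  · intro f hf
    let f' : ℕ → Cv e h w := fun n => if n ∈ R then f0 n else f n
    have hf'R : ∀ n ∈ R, f' n = f0 n := fun n hn => if_pos hn
    have hf'N : ∀ n, n ∉ R → f' n = f n := fun n hn => if_neg hn
    have hπR : ∀ l : Fin (e + 1), l.val < m → π l ∉ R := fun l hl hh =>
      ((hR _).1 hh).2 ((hI _).2 ⟨l, hl, rfl⟩)
    refine exB_intro (SA T) _ _ f f' (fun n hn => hf'N n (by simpa using hn)) ?_
    refine (conj_sat (SA T) f' _ _).2 ?_
    constructor
    · apply chi_A
      intro n hn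
      by_cases hnR : n ∈ R
      · exact hf'R n hnR
      · have : n ∈ I := by
          by_contra hh
          exact hnR ((hR n).2 ⟨hn, hh⟩)
        obtain ⟨l, hl, rfl⟩ := (hI n).1 this
        rw [hf'N _ hnR, hf l hl, hf1 l hl]
    · intro φ hφ
      obtain ⟨r, hr, rfl⟩ := (hmemL φ).1 hφ
      apply (hΦ r hr).2.2.1
      intro l hl
      by_cases hlm : l = mm
      · subst hlm
        rw [Function.update_self, Function.update_self]
        exact (hf'R r hr).trans (hf2 r hr)
      · have hl2 : l.val < m := by
          have : l.val ≠ m := fun hh => hlm (Fin.ext hh)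
          omega
        rw [Function.update_of_ne hlm, Function.update_of_ne hlm]
        exact (hf'N _ (hπR l hl2)).trans (hf l hl2)
  · intro g hg hs
    have hπR : ∀ l : Fin (e + 1), l.val < m → π l ∉ R := fun l hl hh =>
      ((hR _).1 hh).2 ((hI _).2 ⟨l, hl, rfl⟩)
    obtain ⟨g', hg', hs'⟩ := exB_elim (SB T) _ _ g hs
    rw [conj_sat] at hs'
    obtain ⟨hb1, hb2⟩ := hs'
    obtain ⟨h1, h2⟩ := chi_B T f0 _ hb1
    have hgπ : ∀ l : Fin (e + 1), l.val < m → g' (π l) = Sum.inr 1 := by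
      intro l hl
      rw [hg' _ (by simpa using hπR l hl)]
      exact hg l hl
    by_cases hone : ∃ r ∈ R, g' r = Sum.inr 1
    · obtain ⟨r, hr, hr1⟩ := hone
      apply (hΦ r hr).2.2.2 g' _ (hb2 _ ((hmemL _).2 ⟨r, hr, rfl⟩))
      intro l hl
      by_cases hlm : l = mm
      · subst hlm
        rw [Function.update_self]
        exact hr1
      · have hl2 : l.val < m := by
          have : l.val ≠ m := fun hh => hlm (Fin.ext hh)
          omega
        rw [Function.update_of_ne hlm]
        exact hgπ l hl2
    · apply h2
      refine Or.inr ⟨mm, ?_, ?_⟩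
      · intro l hl
        have hl2 : l.val < m := hl
        exact ⟨xs l, 1, rfl, π l, hlt l hl2, hf1 l hl2, hgπ l hl2⟩
      · intro z hz
        obtain ⟨n, hn, rfl⟩ := hy z hz
        have hnk := ((hR n).1 hn).1
        obtain ⟨v, hv⟩ := h1 n hnk
        refine ⟨v, ?_, n, hnk, hf2 n hn, hv⟩
        intro hv1
        apply hone
        refine ⟨n, hn, ?_⟩
        rw [hv, show v = 1 from Fin.ext hv1]
  · intro n hn
    have hnk := hU n (free_sub _ hn)
    have hnR := (exB_free _ _ hn).2
    rw [← hI]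
    by_contra hh
    exact hnR (by simpa using (hR n).2 ⟨hnk, hh⟩)

theorem Dm_all (T : Walk e (Mv h w)) : ∀ d m, m + d = e + 1 → Dm T m := by
  intro d
  induction d with
  | zero =>
    intro m hm
    obtain rfl : m = e + 1 := by omega
    exact Dm_top T
  | succ d ih =>
    intro m hm xs π h1 h2
    obtain ⟨φ, q1, q2, q3, q4, -⟩ := Dm_step T m (by omega) (ih (m + 1) (by omega)) xs π h1 h2
    exact ⟨φ, q1, q2, q3, q4⟩

theorem distinguish (T : Walk e (Mv h w)) :
    ∃ φ : Fml (sig e h w), UsesVars (e + 2) φ ∧ Fml.ExPos φ ∧ IsSentence φ ∧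
      Distinguishes (SA T) (SB T) φ := by
  obtain ⟨φ, q1, q2, q3, q4, q5⟩ := Dm_step T 0 (by omega) (Dm_all T e 1 (by omega))
    (fun _ => 0) (fun _ => 0) (fun _ _ hl => absurd hl (by omega)) (fun _ hl => absurd hl (by omega))
  refine ⟨φ, q2, q1, ?_, fun f => q3 f (fun _ hl => absurd hl (by omega)), fun hB => ?_⟩
  · unfold IsSentence
    rw [Finset.eq_empty_iff_forall_notMem]
    intro n hn
    obtain ⟨l, hl, _⟩ := q5 n hn
    omega
  · exact q4 (fun _ => Sum.inr 0) (fun _ hl => absurd hl (by omega)) (hB _)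
end

/-! ### Parameters -/

theorem params (k n : ℕ) (hk : 4 ≤ k) (hn : 16 * k ^ 2 < n) :
    ∃ h w : ℕ, (k - 2 + 1) * ((k - 2 + 2) + (h + 2) * 2) + (w + 3) = n ∧
      n ^ 2 ≤ 32 * k * Mv h w := by
  obtain ⟨e, rfl⟩ : ∃ e, k = e + 2 := ⟨k - 2, by omega⟩
  simp only [Nat.add_sub_cancel]
  set k := e + 2 with hkdef
  set H := n / (4 * k) with hH
  have hkp : 0 < 4 * k := by omega
  have h1 : 4 * k * H ≤ n := Nat.mul_div_le n (4 * k)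
  have h2 : n < 4 * k * (H + 1) := by
    have := Nat.lt_div_mul_add (a := n) hkp
    rw [← hH] at this
    nlinarith
  have h3 : 2 ≤ H := by
    rw [hH, Nat.le_div_iff_mul_le hkp]
    nlinarith
  have h5 : (e + 1) * (k + H * 2) ≤ k * k + 2 * (k * H) := by
    have : e + 1 ≤ k := by omega
    nlinarith [Nat.mul_le_mul_right (k + H * 2) this]
  have hkk : 16 ≤ k * k := by nlinarith
  have h4 : 4 * (k * H) ≤ n := by nlinarith
  have hn' : 16 * (k * k) < n := by nlinarith
  refine ⟨H - 2, n - (e + 1) * (k + H * 2) - 3, ?_, ?_⟩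
  · rw [show H - 2 + 2 = H by omega]
    omega
  · have hM : H * (n - (e + 1) * (k + H * 2) - 3 + 2) ≤
        Mv (H - 2) (n - (e + 1) * (k + H * 2) - 3) := by
      unfold Mv
      rw [show H - 2 + 2 = H by omega]
      omega
    have h6 : n ≤ 4 * (n - (e + 1) * (k + H * 2) - 3 + 2) := by omega
    have h7 : n ≤ 8 * k * H := by nlinarith
    calc n ^ 2 = n * n := by ring
      _ ≤ (8 * k * H) * (4 * (n - (e + 1) * (k + H * 2) - 3 + 2)) := Nat.mul_le_mul h7 h6
      _ = 32 * k * (H * (n - (e + 1) * (k + H * 2) - 3 + 2)) := by ring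
      _ ≤ _ := Nat.mul_le_mul_left _ hM

theorem card_Cv (e h w : ℕ) :
    Nat.card (Cv e h w) = (e + 1) * ((e + 2) + (h + 2) * 2) + (w + 3) := by
  simp [Nat.card_eq_fintype_card]

theorem expo (e k n M q : ℕ) (hk : 0 < k) (hM : n ^ 2 ≤ 32 * k * M) (hM1 : 1 < M) (he : 0 < e)
    (hq : (q : ℝ) < (2 : ℝ) ^ ((1 / (2 * (32 * (k : ℝ)) ^ e)) * (n : ℝ) ^ (2 * e))) :
    q < 2 ^ (M ^ e - 1) := by
  have h1 : ((n : ℝ) ^ (2 * e)) ≤ (32 * (k : ℝ)) ^ e * (M : ℝ) ^ e := by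
    rw [pow_mul, ← mul_pow]
    apply pow_le_pow_left₀ (by positivity)
    exact_mod_cast hM
  have hp : 2 ≤ M ^ e := Nat.one_lt_pow he.ne' hM1
  have h2 : (1 / (2 * (32 * (k : ℝ)) ^ e)) * (n : ℝ) ^ (2 * e) ≤ ((M ^ e - 1 : ℕ) : ℝ) := by
    have hpos : (0 : ℝ) < (32 * (k : ℝ)) ^ e := by positivity
    rw [Nat.cast_sub (by omega), one_div, inv_mul_le_iff₀ (by positivity)]
    have hp' : (2 : ℝ) ≤ (M : ℝ) ^ e := by exact_mod_cast hp
    push_cast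
    nlinarith
  have h3 : (q : ℝ) < (2 : ℝ) ^ (M ^ e - 1) := by
    refine hq.trans_le ?_
    rw [← Real.rpow_natCast 2 (M ^ e - 1)]
    exact Real.rpow_le_rpow_of_exponent_le (by norm_num) h2
  exact_mod_cast h3

theorem main (k : ℕ) (hk : 4 ≤ k) :
    ∃ ε : ℝ, 0 < ε ∧ ∃ n₀ : ℕ, ∀ n : ℕ, n₀ < n →
      ∃ σ : Signature, (∀ R : σ.symbols, σ.arity R ≤ k) ∧
        ∃ A B : Struct σ,
          Nat.card A.carrier = n ∧ Nat.card B.carrier = n ∧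
          (∃ φ : Fml σ, UsesVars k φ ∧ Fml.ExPos φ ∧ IsSentence φ ∧
            Distinguishes A B φ) ∧
          ∀ φ : Fml σ, UsesVars k φ → Fml.ExPos φ → IsSentence φ →
            (φ.quant : ℝ) < (2 : ℝ) ^ (ε * (n : ℝ) ^ (2 * k - 4)) → AgreeOn A B φ := by
  have hkpos : (0 : ℝ) < k := by exact_mod_cast (show 0 < k by omega)
  refine ⟨1 / (2 * (32 * (k : ℝ)) ^ (k - 2)), by positivity, 16 * k ^ 2, fun n hn => ?_⟩
  obtain ⟨h, w, hcard, hM⟩ := params k n hk hn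
  obtain ⟨e, rfl⟩ : ∃ e, k = e + 2 := ⟨k - 2, by omega⟩
  simp only [Nat.add_sub_cancel] at hcard
  have hM1 : 1 < Mv h w := by unfold Mv; nlinarith
  obtain ⟨T, hT⟩ := exists_walk e (Mv h w) (by omega) hM1
  refine ⟨sig e h w, fun _ => le_rfl, SA T, SB T, ?_, ?_, distinguish T, ?_⟩
  · exact (card_Cv e h w).trans hcard
  · exact (card_Cv e h w).trans hcard
  · intro φ hU hE hS hq
    apply agree T φ hU hE hS
    rw [hT]
    refine expo e (e + 2) n (Mv h w) _ (by omega) hM hM1 (by omega) ?_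
    have : 2 * (e + 2) - 4 = 2 * e := by omega
    rw [this] at hq
    exact hq

end LB

/-- Theorem 3 of the paper. For every integer `k ≥ 4` there exist
`ε > 0` and `n₀` such that for every `n > n₀` there are a finite relational signature
`σ` of arity at most `k` and two `σ`-structures `A, B` with `|A| = |B| = n`,
distinguishable in `∃⁺L^k`, which agree on every sentence of `∃⁺L^k` with fewer than
`2 ^ (ε * n ^ (2k - 4))` quantifiers. -/
theorem statement_2 (k : ℕ) (hk : 4 ≤ k) :
    ∃ ε : ℝ, 0 < ε ∧ ∃ n₀ : ℕ, ∀ n : ℕ, n₀ < n →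
      ∃ σ : Signature, (∀ R : σ.symbols, σ.arity R ≤ k) ∧
        ∃ A B : Struct σ,
          Nat.card A.carrier = n ∧ Nat.card B.carrier = n ∧
          (∃ φ : Fml σ, UsesVars k φ ∧ Fml.ExPos φ ∧ IsSentence φ ∧
            Distinguishes A B φ) ∧
          ∀ φ : Fml σ, UsesVars k φ → Fml.ExPos φ → IsSentence φ →
            (φ.quant : ℝ) < (2 : ℝ) ^ (ε * (n : ℝ) ^ (2 * k - 4)) → AgreeOn A B φ := by
  exact LB.main k hk

end QVT
end

section
/- Let k ≥ 2, let n ≥ 2, and let 𝒜, ℬ be two n-element structures over a common finite relational signature. If some sentence of L^k distinguishes 𝒜 from ℬ, then some sentence φ of L^k with quant(φ) ≤ (n^{n^{k−1}} − 1)/(n − 1) distinguishes 𝒜 from ℬ. -/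
namespace QVT

/-- Atomic equivalence of assignments, on variables below `k`. -/
def AtEq {σ : Signature} (A B : Struct σ) (k : ℕ) (f : ℕ → A.carrier) (g : ℕ → B.carrier) : Prop :=
  (∀ i j, i < k → j < k → (f i = f j ↔ g i = g j)) ∧
  ∀ (R : σ.symbols) (v : Fin (σ.arity R) → ℕ), (∀ x, v x < k) →
    (A.rel R (fun x => f (v x)) ↔ B.rel R (fun x => g (v x)))

/-- Depth `d` back-and-forth equivalence of assignments, with `k` variables. -/
def BF {σ : Signature} (A B : Struct σ) (k : ℕ) : ℕ → (ℕ → A.carrier) → (ℕ → B.carrier) → Prop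
  | 0, f, g => AtEq A B k f g
  | d + 1, f, g => BF A B k d f g ∧ ∀ i, i < k →
      (∀ a, ∃ b, BF A B k d (Function.update f i a) (Function.update g i b)) ∧
      (∀ b, ∃ a, BF A B k d (Function.update f i a) (Function.update g i b))

section basics
variable {σ : Signature}

theorem BF.at {A B : Struct σ} {k : ℕ} : ∀ {d f g}, BF A B k d f g → AtEq A B k f g
  | 0, _, _, h => h
  | _ + 1, _, _, h => BF.at h.1

theorem BF.mono {A B : Struct σ} {k : ℕ} {d e : ℕ} (h : d ≤ e) {f g} (H : BF A B k e f g) :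
    BF A B k d f g := by
  induction h with
  | refl => exact H
  | step _ ih => exact ih H.1

theorem BF.refl (A : Struct σ) (k : ℕ) : ∀ d f, BF A A k d f f
  | 0, _ => ⟨fun _ _ _ _ => Iff.rfl, fun _ _ _ => Iff.rfl⟩
  | d + 1, f => ⟨BF.refl A k d f, fun _ _ => ⟨fun a => ⟨a, BF.refl A k d _⟩,
      fun a => ⟨a, BF.refl A k d _⟩⟩⟩

theorem BF.symm {A B : Struct σ} {k : ℕ} : ∀ {d f g}, BF A B k d f g → BF B A k d g f
  | 0, _, _, h => ⟨fun i j hi hj => (h.1 i j hi hj).symm, fun R v hv => (h.2 R v hv).symm⟩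
  | _ + 1, _, _, h => ⟨BF.symm h.1, fun i hi =>
      ⟨fun b => let ⟨a, ha⟩ := (h.2 i hi).2 b; ⟨a, BF.symm ha⟩,
       fun a => let ⟨b, hb⟩ := (h.2 i hi).1 a; ⟨b, BF.symm hb⟩⟩⟩

theorem BF.trans {A B C : Struct σ} {k : ℕ} :
    ∀ {d f g h}, BF A B k d f g → BF B C k d g h → BF A C k d f h
  | 0, _, _, _, h, h' => ⟨fun i j hi hj => (h.1 i j hi hj).trans (h'.1 i j hi hj),
      fun R v hv => (h.2 R v hv).trans (h'.2 R v hv)⟩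
  | _ + 1, _, _, _, h, h' => ⟨BF.trans h.1 h'.1, fun i hi =>
      ⟨fun a => let ⟨b, hb⟩ := (h.2 i hi).1 a
                let ⟨c, hc⟩ := (h'.2 i hi).1 b
                ⟨c, BF.trans hb hc⟩,
       fun c => let ⟨b, hb⟩ := (h'.2 i hi).2 c
                let ⟨a, ha⟩ := (h.2 i hi).2 b
                ⟨a, BF.trans ha hb⟩⟩⟩

/-- A variable that is not in the image of the other variables. -/
theorem exists_fresh (k i : ℕ) (hi : i < k) (π : ℕ → ℕ) :
    ∃ l, l < k ∧ ∀ j, j < k → j ≠ i → π j ≠ l := by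
  by_contra hcon
  push Not at hcon
  have hsub : Finset.range k ⊆ ((Finset.range k).erase i).image π := by
    intro l hl
    obtain ⟨j, hj, hji, hjl⟩ := hcon l (Finset.mem_range.1 hl)
    exact Finset.mem_image.2 ⟨j, Finset.mem_erase.2 ⟨hji, Finset.mem_range.2 hj⟩, hjl⟩
  have h1 := Finset.card_le_card hsub
  have h2 := (Finset.card_image_le (s := (Finset.range k).erase i) (f := π))
  rw [Finset.card_erase_of_mem (Finset.mem_range.2 hi)] at h2
  simp at h1 h2
  omega

theorem BF.subst {A B : Struct σ} {k : ℕ} : ∀ {d f g f' g'} (π : ℕ → ℕ), BF A B k d f g →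
    (∀ i, i < k → π i < k) → (∀ i, i < k → f' i = f (π i)) → (∀ i, i < k → g' i = g (π i)) →
    BF A B k d f' g' := by
  intro d
  induction d with
  | zero =>
    intro f g f' g' π h hπ hf hg
    refine ⟨fun i j hi hj => ?_, fun R v hv => ?_⟩
    · rw [hf i hi, hf j hj, hg i hi, hg j hj]
      exact h.1 _ _ (hπ i hi) (hπ j hj)
    · have := h.2 R (fun x => π (v x)) (fun x => hπ _ (hv x))
      simp only [hf _ (hv _), hg _ (hv _)]
      exact this
  | succ d ih =>
    intro f g f' g' π h hπ hf hg
    refine ⟨ih π h.1 hπ hf hg, fun i hi => ?_⟩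
    obtain ⟨l, hl, hfresh⟩ := exists_fresh k i hi π
    have key : ∀ a b, BF A B k d (Function.update f l a) (Function.update g l b) →
        BF A B k d (Function.update f' i a) (Function.update g' i b) := by
      intro a b hab
      refine ih (Function.update π i l) hab ?_ ?_ ?_
      all_goals
        intro j hj
        by_cases hji : j = i
        · subst hji; simp [hl]
        · simp [hji, hfresh j hj hji, hπ j hj, hf j hj, hg j hj]
    exact ⟨fun a => let ⟨b, hb⟩ := (h.2 l hl).1 a; ⟨b, key _ _ hb⟩,
      fun b => let ⟨a, ha⟩ := (h.2 l hl).2 b; ⟨a, key _ _ ha⟩⟩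

/-- Equivalent assignments agree on formulas. -/
theorem BF.sat {A B : Struct σ} {k : ℕ} (φ : Fml σ) : UsesVars k φ → ∀ e, ∀ f g, BF A B k (e + φ.depth) f g →
    (Fml.Sat A f φ ↔ Fml.Sat B g φ) := by
  intro hu
  induction φ with
  | eq i j =>
    intro e f g h
    exact h.at.1 i j (hu i (by simp [Fml.vars])) (hu j (by simp [Fml.vars]))
  | rel R v =>
    intro e f g h
    exact h.at.2 R v (fun x => hu _ (by simp [Fml.vars]))
  | not φ ih =>
    intro e f g h
    exact not_congr (ih hu e f g h)
  | and φ ψ ih1 ih2 =>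
    intro e f g h
    simp only [Fml.depth] at h
    exact and_congr
      (ih1 (fun i hi => hu i (by simp [Fml.vars, hi])) 0 f g (h.mono (by omega)))
      (ih2 (fun i hi => hu i (by simp [Fml.vars, hi])) 0 f g (h.mono (by omega)))
  | or φ ψ ih1 ih2 =>
    intro e f g h
    simp only [Fml.depth] at h
    exact or_congr
      (ih1 (fun i hi => hu i (by simp [Fml.vars, hi])) 0 f g (h.mono (by omega)))
      (ih2 (fun i hi => hu i (by simp [Fml.vars, hi])) 0 f g (h.mono (by omega)))
  | ex i φ ih =>
    intro e f g h
    have hi := hu i (by simp [Fml.vars])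
    have ih := ih (fun i hi => hu i (by simp [Fml.vars, hi]))
    have h2 := h.2 i hi
    constructor
    · rintro ⟨a, ha⟩
      obtain ⟨b, hb⟩ := h2.1 a
      exact ⟨b, (ih e _ _ hb).1 ha⟩
    · rintro ⟨b, hb⟩
      obtain ⟨a, ha⟩ := h2.2 b
      exact ⟨a, (ih e _ _ ha).2 hb⟩
  | all i φ ih =>
    intro e f g h
    have hi := hu i (by simp [Fml.vars])
    have ih := ih (fun i hi => hu i (by simp [Fml.vars, hi]))
    have h2 := h.2 i hi
    constructor
    · intro H b
      obtain ⟨a, ha⟩ := h2.2 b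
      exact (ih e _ _ ha).1 (H a)
    · intro H a
      obtain ⟨b, hb⟩ := h2.1 a
      exact (ih e _ _ hb).2 (H b)

theorem sat_congr (M : Struct σ) (φ : Fml σ) : ∀ f g : ℕ → M.carrier,
    (∀ i ∈ φ.freeVars, f i = g i) → (Fml.Sat M f φ ↔ Fml.Sat M g φ) := by
  induction φ with
  | eq i j =>
    intro f g h
    simp only [Fml.Sat]
    rw [h i (by simp [Fml.freeVars]), h j (by simp [Fml.freeVars])]
  | rel R v =>
    intro f g h
    have : (fun m => f (v m)) = fun m => g (v m) := by
      funext x; exact h _ (by simp [Fml.freeVars])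
    simp only [Fml.Sat]
    rw [this]
  | not φ ih => intro f g h; exact not_congr (ih f g h)
  | and φ ψ ih1 ih2 =>
    intro f g h
    exact and_congr (ih1 f g fun i hi => h i (by simp [Fml.freeVars, hi]))
      (ih2 f g fun i hi => h i (by simp [Fml.freeVars, hi]))
  | or φ ψ ih1 ih2 =>
    intro f g h
    exact or_congr (ih1 f g fun i hi => h i (by simp [Fml.freeVars, hi]))
      (ih2 f g fun i hi => h i (by simp [Fml.freeVars, hi]))
  | ex i φ ih =>
    intro f g h
    refine exists_congr fun a => ih _ _ fun j hj => ?_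
    by_cases hji : j = i
    · subst hji; simp
    · simpa [hji] using h j (by simp [Fml.freeVars, hj, hji])
  | all i φ ih =>
    intro f g h
    refine forall_congr' fun a => ih _ _ fun j hj => ?_
    by_cases hji : j = i
    · subst hji; simp
    · simpa [hji] using h j (by simp [Fml.freeVars, hj, hji])

/-- Finite nonempty conjunctions. -/
theorem exists_conj {ι : Type} [Finite ι] [Nonempty ι] (k q : ℕ) (S : Set ℕ) (φ : ι → Fml σ)
    (hk : ∀ i, UsesVars k (φ i)) (hS : ∀ i, ∀ x ∈ (φ i).freeVars, x ∈ S)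
    (hq : ∀ i, (φ i).quant ≤ q) :
    ∃ ψ : Fml σ, UsesVars k ψ ∧ (∀ x ∈ ψ.freeVars, x ∈ S) ∧ ψ.quant ≤ Nat.card ι * q ∧
      ∀ (M : Struct σ) f, Fml.Sat M f ψ ↔ ∀ i, Fml.Sat M f (φ i) := by
  classical
  have := Fintype.ofFinite ι
  suffices H : ∀ s : Finset ι, s.Nonempty → ∃ ψ : Fml σ, UsesVars k ψ ∧
      (∀ x ∈ ψ.freeVars, x ∈ S) ∧ ψ.quant ≤ s.card * q ∧
      ∀ (M : Struct σ) f, Fml.Sat M f ψ ↔ ∀ i ∈ s, Fml.Sat M f (φ i) by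
    obtain ⟨ψ, h1, h2, h3, h4⟩ := H Finset.univ Finset.univ_nonempty
    refine ⟨ψ, h1, h2, ?_, by simpa using h4⟩
    rw [Nat.card_eq_fintype_card]; exact h3
  intro s hs
  induction hs using Finset.Nonempty.cons_induction with
  | singleton a => exact ⟨φ a, hk a, hS a, by simpa using hq a, by simp⟩
  | cons a s ha hs ih =>
    obtain ⟨ψ, h1, h2, h3, h4⟩ := ih
    refine ⟨.and (φ a) ψ, ?_, ?_, ?_, ?_⟩
    · intro i hi
      simp only [Fml.vars, Finset.mem_union] at hi
      exact hi.elim (hk a i) (h1 i)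
    · intro i hi
      simp only [Fml.freeVars, Finset.mem_union] at hi
      exact hi.elim (hS a i) (h2 i)
    · simp only [Fml.quant, Finset.card_cons]
      have := hq a
      rw [add_mul]; omega
    · intro M f
      simp [Fml.Sat, h4]

/-- The geometric sum bounding the number of quantifiers. -/
def qb (n : ℕ) : ℕ → ℕ
  | 0 => 0
  | d + 1 => n * qb n d + 1

theorem qb_eq (n : ℕ) (hn : 2 ≤ n) (d : ℕ) : qb n d = (n ^ d - 1) / (n - 1) := by
  obtain ⟨p, rfl⟩ : ∃ p, n = p + 1 := ⟨n - 1, by omega⟩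
  have h : p * qb (p + 1) d + 1 = (p + 1) ^ d := by
    induction d with
    | zero => simp [qb]
    | succ d ih => rw [pow_succ, ← ih]; simp only [qb]; ring
  rw [← h]
  simp only [Nat.add_sub_cancel]
  rw [Nat.mul_div_cancel_left _ (by omega)]

theorem qb_add (n : ℕ) (hn : 2 ≤ n) (d m : ℕ) : m + n ^ m * qb n d ≤ qb n (d + m) := by
  induction m with
  | zero => simp
  | succ m ih =>
    have : qb n (d + (m + 1)) = n * qb n (d + m) + 1 := rfl
    rw [this, pow_succ]
    have h1 := Nat.mul_le_mul_left n ih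
    nlinarith

theorem qb_succ_le (n : ℕ) (hn : 2 ≤ n) (d : ℕ) : qb n d ≤ qb n (d + 1) := by
  simp only [qb]; nlinarith

/-- Inequivalent assignments are separated by a formula with few quantifiers. -/
theorem exists_fml (k n : ℕ) (hn : 2 ≤ n) (A B : Struct σ) (hA : Nat.card A.carrier = n)
    (hB : Nat.card B.carrier = n) : ∀ (d : ℕ) (f : ℕ → A.carrier) (g : ℕ → B.carrier)
    (f' : ℕ → A.carrier) (g' : ℕ → B.carrier) (π : ℕ → ℕ) (S : Set ℕ),
    (∀ i, i < k → π i < k) → (∀ i, i < k → π i ∈ S) →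
    (∀ i, i < k → f' i = f (π i)) → (∀ i, i < k → g' i = g (π i)) →
    ¬ BF A B k d f' g' → ∃ φ : Fml σ, UsesVars k φ ∧ (∀ x ∈ φ.freeVars, x ∈ S) ∧
      φ.quant ≤ qb n d ∧ Fml.Sat A f φ ∧ ¬ Fml.Sat B g φ := by
  have : Finite A.carrier := Nat.finite_of_card_ne_zero (by omega)
  have : Finite B.carrier := Nat.finite_of_card_ne_zero (by omega)
  have : Nonempty A.carrier := (Nat.card_pos_iff.1 (by omega)).1
  have : Nonempty B.carrier := (Nat.card_pos_iff.1 (by omega)).1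
  intro d
  induction d with
  | zero =>
    intro f g f' g' π S hπ hS hf hg h
    have pol : ∀ φ : Fml σ, UsesVars k φ → (∀ x ∈ φ.freeVars, x ∈ S) → φ.quant = 0 →
        ¬ (Fml.Sat A f φ ↔ Fml.Sat B g φ) → ∃ φ : Fml σ, UsesVars k φ ∧
        (∀ x ∈ φ.freeVars, x ∈ S) ∧ φ.quant ≤ qb n 0 ∧ Fml.Sat A f φ ∧ ¬ Fml.Sat B g φ := by
      intro φ h1 h2 h3 h4
      by_cases h5 : Fml.Sat A f φ
      · exact ⟨φ, h1, h2, by omega, h5, fun h6 => h4 ⟨fun _ => h6, fun _ => h5⟩⟩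
      · refine ⟨.not φ, h1, h2, by simp [Fml.quant, h3], h5, fun h6 => h4 ⟨fun h => (h5 h).elim, fun h => (h6 h).elim⟩⟩
    simp only [BF, AtEq, not_and_or, not_forall] at h
    rcases h with ⟨i, j, hi, hj, h⟩ | ⟨R, v, hv, h⟩
    · rw [hf i hi, hf j hj, hg i hi, hg j hj] at h
      refine pol (.eq (π i) (π j)) ?_ ?_ rfl h
      · intro x hx
        simp only [Fml.vars, Finset.mem_insert, Finset.mem_singleton] at hx
        rcases hx with rfl | rfl
        exacts [hπ i hi, hπ j hj]
      · intro x hx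
        simp only [Fml.freeVars, Finset.mem_insert, Finset.mem_singleton] at hx
        rcases hx with rfl | rfl
        exacts [hS i hi, hS j hj]
    · simp only [hf _ (hv _), hg _ (hv _)] at h
      refine pol (.rel R (fun x => π (v x))) ?_ ?_ rfl h
      · intro x hx
        simp only [Fml.vars, Finset.mem_image] at hx
        obtain ⟨y, _, rfl⟩ := hx
        exact hπ _ (hv y)
      · intro x hx
        simp only [Fml.freeVars, Finset.mem_image] at hx
        obtain ⟨y, _, rfl⟩ := hx
        exact hS _ (hv y)
  | succ d ih =>
    intro f g f' g' π S hπ hS hf hg h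
    by_cases h0 : BF A B k d f' g'
    swap
    · obtain ⟨φ, h1, h2, h3, h4⟩ := ih f g f' g' π S hπ hS hf hg h0
      exact ⟨φ, h1, h2, h3.trans (qb_succ_le n hn d), h4⟩
    simp only [BF, h0, true_and, not_forall] at h
    obtain ⟨i, hi, h⟩ := h
    obtain ⟨l, hl, hfresh⟩ := exists_fresh k i hi π
    have key : ∀ a b, ¬ BF A B k d (Function.update f' i a) (Function.update g' i b) →
        ∃ φ : Fml σ, UsesVars k φ ∧ (∀ x ∈ φ.freeVars, x ∈ insert l S) ∧ φ.quant ≤ qb n d ∧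
          Fml.Sat A (Function.update f l a) φ ∧ ¬ Fml.Sat B (Function.update g l b) φ := by
      intro a b hab
      refine ih _ _ _ _ (Function.update π i l) (insert l S) ?_ ?_ ?_ ?_ hab
      all_goals
        intro j hj
        by_cases hji : j = i
        · subst hji; simp [hl]
        · simp [hji, hfresh j hj hji, hπ j hj, hf j hj, hg j hj, hS j hj]
    have uex : ∀ ψ : Fml σ, UsesVars k ψ → UsesVars k (.ex l ψ) := by
      intro ψ hψ x hx
      simp only [Fml.vars, Finset.mem_insert] at hx
      rcases hx with rfl | hx
      exacts [hl, hψ x hx]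
    have fex : ∀ ψ : Fml σ, (∀ x ∈ ψ.freeVars, x ∈ insert l S) →
        ∀ x ∈ (Fml.ex l ψ).freeVars, x ∈ S := by
      intro ψ hψ x hx
      simp only [Fml.freeVars, Finset.mem_erase] at hx
      exact (Set.mem_insert_iff.1 (hψ x hx.2)).resolve_left hx.1
    rw [not_and_or] at h
    push Not at h
    rcases h with ⟨a, h⟩ | ⟨b, h⟩
    · choose φ h1 h2 h3 h4 h5 using fun b => key a b (h b)
      obtain ⟨ψ, u, s, q, hs⟩ := exists_conj k (qb n d) _ φ h1 h2 h3
      refine ⟨.ex l ψ, uex ψ u, fex ψ s, ?_, ⟨a, (hs _ _).2 h4⟩, ?_⟩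
      · rw [hB] at q; simpa [Fml.quant, qb] using q
      · rintro ⟨b, hb⟩
        exact h5 b ((hs _ _).1 hb b)
    · choose φ h1 h2 h3 h4 h5 using fun a => key a b (h a)
      obtain ⟨ψ, u, s, q, hs⟩ := exists_conj k (qb n d) _ (fun a => .not (φ a)) h1 h2 h3
      refine ⟨.not (.ex l ψ), uex ψ u, fex ψ s, ?_, ?_, fun H => H ⟨b, (hs _ _).2 h5⟩⟩
      · rw [hA] at q; simpa [Fml.quant, qb] using q
      · rintro ⟨a, ha⟩
        exact (hs _ _).1 ha a (h4 a)

/-- Prefix of existential quantifiers on variables below `j`. -/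
def exs : ℕ → Fml σ → Fml σ
  | 0, φ => φ
  | j + 1, φ => exs j (.ex j φ)

theorem exs_quant (j : ℕ) : ∀ φ : Fml σ, (exs j φ).quant = j + φ.quant := by
  induction j with
  | zero => intro φ; simp [exs]
  | succ j ih => intro φ; simp only [exs, ih, Fml.quant]; omega

theorem exs_vars (j k : ℕ) (hj : j ≤ k) : ∀ φ : Fml σ, UsesVars k φ → UsesVars k (exs j φ) := by
  induction j with
  | zero => intro φ h; exact h
  | succ j ih =>
    intro φ h
    refine ih (by omega) _ ?_
    intro x hx
    simp only [Fml.vars, Finset.mem_insert] at hx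
    rcases hx with rfl | hx
    exacts [by omega, h x hx]

theorem exs_free (j : ℕ) : ∀ φ : Fml σ, (∀ x ∈ φ.freeVars, x < j) → IsSentence (exs j φ) := by
  induction j with
  | zero => intro φ h; exact Finset.eq_empty_of_forall_notMem fun x hx => by simpa using h x hx
  | succ j ih =>
    intro φ h
    refine ih _ ?_
    intro x hx
    simp only [Fml.freeVars, Finset.mem_erase] at hx
    have := h x hx.2
    omega

theorem exs_sat (M : Struct σ) (j : ℕ) : ∀ (φ : Fml σ) (f : ℕ → M.carrier),
    Fml.Sat M f (exs j φ) ↔ ∃ f', (∀ i, j ≤ i → f' i = f i) ∧ Fml.Sat M f' φ := by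
  induction j with
  | zero =>
    intro φ f
    constructor
    · intro h; exact ⟨f, fun _ _ => rfl, h⟩
    · rintro ⟨f', h, h'⟩
      have : f' = f := funext fun i => h i (by omega)
      rw [← this]; exact h'
  | succ j ih =>
    intro φ f
    simp only [exs, ih, Fml.Sat]
    constructor
    · rintro ⟨f', h, a, ha⟩
      refine ⟨_, fun i hi => ?_, ha⟩
      rw [Function.update_of_ne (by omega)]
      exact h i (by omega)
    · rintro ⟨f', h, h'⟩
      refine ⟨Function.update f' j (f j), fun i hi => ?_, f' j, ?_⟩
      · by_cases hij : i = j
        · subst hij; simp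
        · rw [Function.update_of_ne hij]; exact h i (by omega)
      · simpa using h'

/-- Pad an `m`-tuple to a total assignment. -/
def pad {m : ℕ} (hm : 0 < m) {X : Type} (s : Fin m → X) : ℕ → X :=
  fun i => s ⟨min i (m - 1), by omega⟩

theorem exists_sentence (m n : ℕ) (hm : 0 < m) (hn : 2 ≤ n) (A B : Struct σ)
    (hA : Nat.card A.carrier = n) (hB : Nat.card B.carrier = n) (d : ℕ) (s : Fin m → A.carrier)
    (h : ∀ t : Fin m → B.carrier, ¬ BF A B (m + 1) d (pad hm s) (pad hm t)) :
    ∃ φ : Fml σ, UsesVars (m + 1) φ ∧ IsSentence φ ∧ φ.quant ≤ qb n (d + m) ∧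
      (∀ f, Fml.Sat A f φ) ∧ ∀ g, ¬ Fml.Sat B g φ := by
  have : Finite B.carrier := Nat.finite_of_card_ne_zero (by omega)
  have : Nonempty B.carrier := (Nat.card_pos_iff.1 (by omega)).1
  choose φ h1 h2 h3 h4 h5 using fun t => exists_fml (m + 1) n hn A B hA hB d (pad hm s) (pad hm t)
    (pad hm s) (pad hm t) (fun i => min i (m - 1)) {x | x < m} (by intro i hi; show min i (m - 1) < m + 1; omega)
    (by intro i hi; show min i (m - 1) < m; omega) (by intro i hi; simp [pad]) (by intro i hi; simp [pad]) (h t)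
  obtain ⟨ψ, u, fs, q, hs⟩ := exists_conj (m + 1) (qb n d) _ φ h1 h2 h3
  have agree : ∀ (M : Struct σ) (f : ℕ → M.carrier) (s : Fin m → M.carrier),
      (∀ i : Fin m, f i = s i) → (Fml.Sat M f ψ ↔ Fml.Sat M (pad hm s) ψ) := by
    intro M f s hf
    refine sat_congr M ψ _ _ fun i hi => ?_
    have him : i < m := fs i hi
    have e : (⟨min i (m - 1), by omega⟩ : Fin m) = ⟨i, him⟩ := by
      apply Fin.ext; simp; omega
    simp only [pad, e]
    exact hf ⟨i, him⟩
  refine ⟨exs m ψ, exs_vars m _ (by omega) ψ u, exs_free m ψ fs, ?_, ?_, ?_⟩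
  · rw [exs_quant]
    refine le_trans ?_ (qb_add n hn d m)
    have : Nat.card (Fin m → B.carrier) = n ^ m := by simp [Nat.card_fun, hB]
    rw [this] at q; omega
  · intro f
    rw [exs_sat]
    refine ⟨fun i => if hi : i < m then s ⟨i, hi⟩ else f i, fun i hi => ?_, ?_⟩
    · simp [Nat.not_lt.2 hi]
    · rw [agree A _ s (fun i => by simp), hs]
      exact h4
  · intro g
    rw [exs_sat]
    rintro ⟨f', _, h'⟩
    rw [agree B f' (fun i => f' i) (fun i => rfl), hs] at h'
    exact h5 _ (h' _)

/-- If equivalence of padded tuples is stable at `d`, then equivalence is stable at `d`. -/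
theorem stable_step {m d : ℕ} (hm : 0 < m) {A B : Struct σ}
    (H : ∀ (s : Fin m → A.carrier) (t : Fin m → B.carrier),
      BF A B (m + 1) d (pad hm s) (pad hm t) → BF A B (m + 1) (d + 1) (pad hm s) (pad hm t))
    (f : ℕ → A.carrier) (g : ℕ → B.carrier) (h : BF A B (m + 1) d f g) :
    BF A B (m + 1) (d + 1) f g := by
  refine ⟨h, fun i hi => ?_⟩
  let π : ℕ → ℕ := fun j => if j < i then j else j + 1
  let s : Fin m → A.carrier := fun j => f (π j)
  let t : Fin m → B.carrier := fun j => g (π j)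
  have h1 : BF A B (m + 1) d (pad hm s) (pad hm t) := by
    refine h.subst (fun j => π (min j (m - 1))) ?_ (fun _ _ => rfl) (fun _ _ => rfl)
    intro j hj
    simp only [π]
    split_ifs <;> omega
  have h2 := (H s t h1).2 m (by omega)
  let π' : ℕ → ℕ := fun j => if j < i then j else if j = i then m else j - 1
  have key : ∀ a b, BF A B (m + 1) d (Function.update (pad hm s) m a)
      (Function.update (pad hm t) m b) →
      BF A B (m + 1) d (Function.update f i a) (Function.update g i b) := by
    intro a b hab
    have aux : ∀ {X : Type} (f : ℕ → X) (a : X) (j : ℕ), j < m + 1 →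
        Function.update f i a j =
          Function.update (pad hm (fun j : Fin m => f (π j))) m a (π' j) := by
      intro X f a j hj
      by_cases hji : j = i
      · subst hji; simp [π']
      · have hne : π' j ≠ m := by simp only [π']; split_ifs <;> omega
        rw [Function.update_of_ne hji, Function.update_of_ne hne]
        simp only [pad]
        congr 1
        simp only [π, π']
        split_ifs <;> omega
    refine hab.subst π' ?_ (aux f a) (aux g b)
    intro j hj
    simp only [π']
    split_ifs <;> omega
  exact ⟨fun a => let ⟨b, hb⟩ := h2.1 a; ⟨b, key _ _ hb⟩,
    fun b => let ⟨a, ha⟩ := h2.2 b; ⟨a, key _ _ ha⟩⟩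

theorem stable_all {k d : ℕ} {A B : Struct σ}
    (H : ∀ f g, BF A B k d f g → BF A B k (d + 1) f g) :
    ∀ e f g, BF A B k d f g → BF A B k e f g := by
  intro e
  induction e with
  | zero => intro f g h; exact h.mono (by omega)
  | succ e ih =>
    intro f g h
    refine ⟨ih f g h, fun i hi => ?_⟩
    have h2 := (H f g h).2 i hi
    exact ⟨fun a => let ⟨b, hb⟩ := h2.1 a; ⟨b, ih _ _ hb⟩,
      fun b => let ⟨a, ha⟩ := h2.2 b; ⟨a, ih _ _ ha⟩⟩

/-- The equivalence relation on `m`-tuples. -/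
def tupS (A : Struct σ) {m : ℕ} (hm : 0 < m) (d : ℕ) : Setoid (Fin m → A.carrier) where
  r s t := BF A A (m + 1) d (pad hm s) (pad hm t)
  iseqv := ⟨fun _ => BF.refl _ _ _ _, fun h => h.symm, fun h h' => h.trans h'⟩

/-- Number of classes of `m`-tuples. -/
noncomputable def ncl (A : Struct σ) {m : ℕ} (hm : 0 < m) (d : ℕ) : ℕ :=
  Nat.card (Quotient (tupS A hm d))

theorem ncl_lt {A : Struct σ} [Finite A.carrier] {m : ℕ} (hm : 0 < m) (d : ℕ)
    (s t : Fin m → A.carrier) (h : BF A A (m + 1) d (pad hm s) (pad hm t))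
    (h' : ¬ BF A A (m + 1) (d + 1) (pad hm s) (pad hm t)) : ncl A hm d < ncl A hm (d + 1) := by
  classical
  have := Fintype.ofFinite (Quotient (tupS A hm d))
  have := Fintype.ofFinite (Quotient (tupS A hm (d + 1)))
  unfold ncl
  rw [Nat.card_eq_fintype_card, Nat.card_eq_fintype_card]
  let F : Quotient (tupS A hm (d + 1)) → Quotient (tupS A hm d) :=
    Quotient.map' id (fun a b (hab : BF A A (m + 1) (d + 1) (pad hm a) (pad hm b)) => hab.1)
  refine Fintype.card_lt_of_surjective_not_injective F ?_ ?_
  · intro q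
    induction q using Quotient.inductionOn with
    | h a => exact ⟨Quotient.mk _ a, rfl⟩
  · intro hinj
    have e : F (Quotient.mk _ s) = F (Quotient.mk _ t) :=
      Quotient.sound (s := tupS A hm d) h
    exact h' (Quotient.exact (s := tupS A hm (d + 1)) (hinj e))

theorem ncl_discrete {A : Struct σ} [Finite A.carrier] {m : ℕ} (hm : 0 < m) (d : ℕ)
    (hc : Nat.card (Fin m → A.carrier) ≤ ncl A hm d) (s t : Fin m → A.carrier)
    (h : BF A A (m + 1) d (pad hm s) (pad hm t)) : s = t := by
  have h1 : Function.Surjective (Quotient.mk (tupS A hm d)) := Quotient.mk_surjective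
  have h2 := Nat.card_le_card_of_surjective _ h1
  exact ((Nat.bijective_iff_surjective_and_card _).2 ⟨h1, le_antisymm hc h2⟩).1
    (Quotient.sound (s := tupS A hm d) h)

theorem ncl_double {A : Struct σ} [Finite A.carrier] {m : ℕ} (hm : 0 < m) (d : ℕ)
    (hc : Nat.card (Fin m → A.carrier) ≤ ncl A hm d + 1) (x y z w : Fin m → A.carrier)
    (hxy : x ≠ y) (h : BF A A (m + 1) d (pad hm x) (pad hm y)) (hzw : z ≠ w)
    (h' : BF A A (m + 1) d (pad hm z) (pad hm w)) : z = x ∨ w = x := by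
  classical
  by_contra hcon
  rw [not_or] at hcon
  let F : {u : Fin m → A.carrier // u ≠ x} → Quotient (tupS A hm d) := fun u => Quotient.mk _ u.1
  have h1 : Function.Surjective F := by
    intro q
    induction q using Quotient.inductionOn with
    | h a =>
      by_cases hax : a = x
      · subst hax
        exact ⟨⟨y, hxy.symm⟩, Quotient.sound (s := tupS A hm d) h.symm⟩
      · exact ⟨⟨a, hax⟩, rfl⟩
  have h2 := Nat.card_le_card_of_surjective _ h1
  have := Fintype.ofFinite A.carrier
  have h3 : Nat.card {u : Fin m → A.carrier // u ≠ x} = Nat.card (Fin m → A.carrier) - 1 := by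
    rw [Nat.card_eq_fintype_card, Nat.card_eq_fintype_card, Fintype.card_subtype_compl]
    simp
  have h4 := ((Nat.bijective_iff_surjective_and_card F).2 ⟨h1, by
    apply le_antisymm _ h2
    rw [h3]; unfold ncl at hc; omega⟩).1
  have := @h4 ⟨z, hcon.1⟩ ⟨w, hcon.2⟩ (Quotient.sound (s := tupS A hm d) h')
  exact hzw (congrArg Subtype.val this)

theorem pad_lt {m : ℕ} (hm : 0 < m) {X : Type} (s : Fin m → X) (i : Fin m) :
    pad hm s i = s i := by
  unfold pad
  congr 1
  apply Fin.ext
  simp; omega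

theorem BF.tup_eq {A B : Struct σ} {m d : ℕ} {hm : 0 < m} {s : Fin m → A.carrier}
    {t : Fin m → B.carrier} (h : BF A B (m + 1) d (pad hm s) (pad hm t)) (i j : Fin m) :
    s i = s j ↔ t i = t j := by
  have := h.at.1 i j (by omega) (by omega)
  simpa only [pad_lt] using this

/-- Initial number of classes. -/
theorem ncl_zero {A : Struct σ} [Finite A.carrier] {m : ℕ} (hm : 0 < m)
    (a b : A.carrier) (hab : a ≠ b) :
    m ≤ ncl A hm 0 ∧ (3 ≤ m → m + 1 ≤ ncl A hm 0) := by
  classical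
  have big : 3 ≤ m → m + 1 ≤ ncl A hm 0 := by
    intro h3
    let F : Option (Fin m) → Quotient (tupS A hm 0) := fun o =>
      Quotient.mk _ (o.elim (fun _ => a) (fun j => Function.update (fun _ => a) j b))
    have hF : Function.Injective F := by
      have none_some : ∀ j, F none ≠ F (some j) := by
        intro j h
        have h := Quotient.exact (s := tupS A hm 0) h
        obtain ⟨i, hi⟩ : ∃ i : Fin m, i ≠ j := by
          have : Nontrivial (Fin m) := Fin.nontrivial_iff_two_le.2 (by omega)
          exact exists_ne j
        have := (BF.tup_eq h i j).1 rfl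
        simp [hi] at this
        exact hab this
      rintro (_ | j) (_ | j') h
      · rfl
      · exact (none_some _ h).elim
      · exact (none_some _ h.symm).elim
      · by_contra hne
        have hjj : j ≠ j' := fun e => hne (by rw [e])
        have h := Quotient.exact (s := tupS A hm 0) h
        obtain ⟨i, hi⟩ : ∃ i : Fin m, i ∉ ({j, j'} : Finset (Fin m)) := by
          by_contra hall
          push Not at hall
          have h1 := Finset.card_le_card (fun i _ => hall i : (Finset.univ : Finset (Fin m)) ⊆ _)
          have h2 := Finset.card_le_two (a := j) (b := j')
          simp only [Finset.card_univ, Fintype.card_fin] at h1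
          omega
        simp only [Finset.mem_insert, Finset.mem_singleton, not_or] at hi
        have := (BF.tup_eq h i j).2 (by simp [hi.2, hjj])
        simp [hi.1] at this
        exact hab this
    have := Nat.card_le_card_of_injective F hF
    simpa [ncl] using this
  refine ⟨?_, big⟩
  rcases Nat.lt_or_ge m 3 with h3 | h3
  · have pos : 0 < ncl A hm 0 := by
      have : Nonempty (Quotient (tupS A hm 0)) := ⟨Quotient.mk _ (fun _ => a)⟩
      exact Nat.card_pos
    by_cases h1 : m = 1
    · omega
    · have h2 : m = 2 := by omega
      subst h2
      have : Nontrivial (Quotient (tupS A hm 0)) := by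
        refine ⟨⟨Quotient.mk _ (fun _ => a), Quotient.mk _ (Function.update (fun _ => a) 1 b), ?_⟩⟩
        intro h
        have h := Quotient.exact (s := tupS A hm 0) h
        have := (BF.tup_eq h 0 1).1 rfl
        simp at this
        exact hab this
      exact Finite.one_lt_card
  · have := big h3; omega

/-- Growth of the number of classes. -/
theorem ncl_growth {A B : Struct σ} [Finite A.carrier] {m : ℕ} (hm : 0 < m) (K : ℕ)
    (bs : ∀ t : Fin m → B.carrier, ∃ s : Fin m → A.carrier, BF A B (m + 1) K (pad hm s) (pad hm t))
    (ns : ∀ d, d < K → ∃ (s : Fin m → A.carrier) (t : Fin m → B.carrier),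
      BF A B (m + 1) d (pad hm s) (pad hm t) ∧ ¬ BF A B (m + 1) (d + 1) (pad hm s) (pad hm t)) :
    ∀ d, d ≤ K → ncl A hm 0 + d ≤ ncl A hm d := by
  intro d
  induction d with
  | zero => intro _; simp
  | succ d ih =>
    intro hd
    obtain ⟨s, t, h, h'⟩ := ns d (by omega)
    obtain ⟨s', hs'⟩ := bs t
    have h1 : BF A A (m + 1) d (pad hm s) (pad hm s') := h.trans (hs'.mono (by omega)).symm
    have h2 := ncl_lt hm d s s' h1 (fun h3 => h' (h3.trans (hs'.mono (by omega))))
    have := ih (by omega)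
    omega

/-- Isomorphism-type criterion. -/
theorem bf_of_rel {A B : Struct σ} {k : ℕ} (r : A.carrier → B.carrier → Prop)
    (hl : ∀ a, ∃ b, r a b) (hr : ∀ b, ∃ a, r a b)
    (H : ∀ f g, (∀ i, i < k → r (f i) (g i)) → AtEq A B k f g) :
    ∀ d f g, (∀ i, i < k → r (f i) (g i)) → BF A B k d f g := by
  intro d
  induction d with
  | zero => exact H
  | succ d ih =>
    intro f g h
    have key : ∀ i a b, r a b →
        BF A B k d (Function.update f i a) (Function.update g i b) := by
      intro i a b hab
      refine ih _ _ fun j hj => ?_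
      by_cases hji : j = i
      · subst hji; simpa using hab
      · simpa [hji] using h j hj
    exact ⟨ih f g h, fun i _ => ⟨fun a => let ⟨b, hb⟩ := hl a; ⟨b, key i a b hb⟩,
      fun b => let ⟨a, ha⟩ := hr b; ⟨a, key i a b ha⟩⟩⟩

theorem const_total {A B : Struct σ} {m K : ℕ} (hm : 0 < m)
    (bs : ∀ s : Fin m → A.carrier, ∃ t : Fin m → B.carrier, BF A B (m + 1) K (pad hm s) (pad hm t))
    (a : A.carrier) : ∃ b : B.carrier, BF A B (m + 1) K (fun _ => a) (fun _ => b) := by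
  obtain ⟨t, ht⟩ := bs (fun _ => a)
  exact ⟨t ⟨0, hm⟩, ht.subst (fun _ => 0) (fun _ _ => by omega) (fun _ _ => rfl)
    (fun _ _ => by simp [pad])⟩

theorem const_unique {A : Struct σ} [Finite A.carrier] {m K : ℕ} (hm : 0 < m)
    (hc : Nat.card (Fin m → A.carrier) ≤ ncl A hm K) (a b : A.carrier)
    (h : BF A A (m + 1) K (fun _ => a) (fun _ => b)) : a = b :=
  congrFun (ncl_discrete hm K hc (fun _ => a) (fun _ => b) h) ⟨0, hm⟩

theorem atEq_one {A B : Struct σ} [Finite A.carrier] [Finite B.carrier] {K : ℕ} (hm : 0 < 1)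
    (hcA : Nat.card (Fin 1 → A.carrier) ≤ ncl A hm (K + 1))
    (hcB : Nat.card (Fin 1 → B.carrier) ≤ ncl B hm (K + 1))
    (hcB' : Nat.card (Fin 1 → B.carrier) ≤ ncl B hm K + 1)
    (f : ℕ → A.carrier) (g : ℕ → B.carrier)
    (h : ∀ i, i < 2 → BF A B 2 (K + 1) (fun _ => f i) (fun _ => g i)) : AtEq A B 2 f g := by
  have h0 := h 0 (by omega)
  have h1 := h 1 (by omega)
  by_cases hac : f 0 = f 1
  · have hac' : g 0 = g 1 := by
      rw [← hac] at h1
      exact const_unique hm hcB _ _ (h0.symm.trans h1)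
    refine (h0.subst id (fun _ h => h) ?_ ?_).at <;>
    · intro i hi
      obtain rfl | rfl : i = 0 ∨ i = 1 := by omega
      · rfl
      · simp [hac, hac']
  obtain ⟨z, hz⟩ := (h0.2 1 (by omega)).1 (f 1)
  obtain ⟨w, hw⟩ := (h1.2 0 (by omega)).1 (f 0)
  by_cases hzc : z = g 1
  · refine (hz.subst id (fun _ h => h) ?_ ?_).at <;>
    · intro i hi
      obtain rfl | rfl : i = 0 ∨ i = 1 := by omega
      all_goals simp [hzc]
  by_cases hwa : w = g 0
  · refine (hw.subst id (fun _ h => h) ?_ ?_).at <;>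
    · intro i hi
      obtain rfl | rfl : i = 0 ∨ i = 1 := by omega
      all_goals simp [hwa]
  exfalso
  have e1 : BF A B 2 K (fun _ => f 1) (fun _ => z) :=
    hz.subst (fun _ => 1) (fun _ _ => by omega) (fun _ _ => by simp) (fun _ _ => by simp)
  have e2 : BF A B 2 K (fun _ => f 0) (fun _ => w) :=
    hw.subst (fun _ => 0) (fun _ _ => by omega) (fun _ _ => by simp) (fun _ _ => by simp)
  have e3 : BF B B 2 K (fun _ => g 1) (fun _ => z) := h1.1.symm.trans e1
  have e4 : BF B B 2 K (fun _ => g 0) (fun _ => w) := h0.1.symm.trans e2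
  rcases ncl_double hm K hcB' (fun _ => g 1) (fun _ => z) (fun _ => g 0) (fun _ => w)
    (fun e => hzc (congrFun e 0).symm) e3 (fun e => hwa (congrFun e 0).symm) e4 with e | e
  · have e : g 0 = g 1 := congrFun e 0
    rw [← e] at h1
    exact hac (const_unique hm hcA _ _ (h0.trans h1.symm))
  · have e : w = g 1 := congrFun e 0
    have := (hw.at.1 0 1 (by omega) (by omega)).2 (by simp [e])
    simp at this
    exact hac this

theorem pair_bf {A B : Struct σ} [Finite B.carrier] {K : ℕ} (hm : 0 < 2)
    (hcB : Nat.card (Fin 2 → B.carrier) ≤ ncl B hm K)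
    (bs : ∀ s : Fin 2 → A.carrier, ∃ t : Fin 2 → B.carrier, BF A B 3 K (pad hm s) (pad hm t))
    (a b : A.carrier) (a' b' : B.carrier) (h0 : BF A B 3 K (fun _ => a) (fun _ => a'))
    (h1 : BF A B 3 K (fun _ => b) (fun _ => b')) :
    BF A B 3 K (pad hm ![a, b]) (pad hm ![a', b']) := by
  obtain ⟨t, ht⟩ := bs ![a, b]
  have e0 : BF A B 3 K (fun _ => a) (fun _ => t 0) :=
    ht.subst (fun _ => 0) (fun _ _ => by omega) (fun _ _ => by simp [pad]) (fun _ _ => by simp [pad])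
  have e1 : BF A B 3 K (fun _ => b) (fun _ => t 1) :=
    ht.subst (fun _ => 1) (fun _ _ => by omega) (fun _ _ => by simp [pad]) (fun _ _ => by simp [pad])
  have f0 := const_unique hm hcB _ _ (h0.symm.trans e0)
  have f1 := const_unique hm hcB _ _ (h1.symm.trans e1)
  have : t = ![a', b'] := by
    funext i
    fin_cases i
    · exact f0.symm
    · exact f1.symm
  rw [← this]; exact ht

theorem atEq_two {A B : Struct σ} [Finite B.carrier] {K : ℕ} (hm : 0 < 2)
    (hcB : Nat.card (Fin 2 → B.carrier) ≤ ncl B hm (K + 1))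
    (hcB' : Nat.card (Fin 2 → B.carrier) ≤ ncl B hm K + 1)
    (bs : ∀ s : Fin 2 → A.carrier, ∃ t : Fin 2 → B.carrier,
      BF A B 3 (K + 1) (pad hm s) (pad hm t))
    (f : ℕ → A.carrier) (g : ℕ → B.carrier)
    (h : ∀ i, i < 3 → BF A B 3 (K + 1) (fun _ => f i) (fun _ => g i)) : AtEq A B 3 f g := by
  have h0 := h 0 (by omega)
  have h1 := h 1 (by omega)
  have h2 := h 2 (by omega)
  have p01 := pair_bf hm hcB bs _ _ _ _ h0 h1
  have p02 := pair_bf hm hcB bs _ _ _ _ h0 h2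
  obtain ⟨e, he⟩ := (p01.2 2 (by omega)).1 (f 2)
  by_cases hec : e = g 2
  · refine (he.subst id (fun _ h => h) ?_ ?_).at <;>
    · intro i hi
      obtain rfl | rfl | rfl : i = 0 ∨ i = 1 ∨ i = 2 := by omega
      all_goals simp [hec, pad]
  exfalso
  have e1 : BF A B 3 K (fun _ => f 2) (fun _ => e) :=
    he.subst (fun _ => 2) (fun _ _ => by omega) (fun _ _ => by simp) (fun _ _ => by simp)
  have e2 : BF A B 3 K (pad hm ![f 0, f 2]) (pad hm ![g 0, e]) := by
    refine he.subst (fun i => if i = 0 then 0 else 2) ?_ ?_ ?_ <;>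
    · intro i hi
      obtain rfl | rfl | rfl : i = 0 ∨ i = 1 ∨ i = 2 := by omega
      all_goals simp [pad]
  have d1 : BF B B 3 K (fun _ => g 2) (fun _ => e) := h2.1.symm.trans e1
  have d2 := p02.1.symm.trans e2
  have n1 : (fun _ : Fin 2 => g 2) ≠ fun _ => e := fun E => hec (congrFun E 0).symm
  have n2 : ![g 0, g 2] ≠ ![g 0, e] := fun E => hec (congrFun E 1).symm
  have c1 := ncl_double hm K hcB' _ _ (fun _ => g 2) (fun _ => e) n2 d2 n1 d1
  have c2 := ncl_double hm K hcB' _ _ (fun _ => g 2) (fun _ => e) n2.symm d2.symm n1 d1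
  have hg : g 2 = g 0 := by
    rcases c1 with E | E
    · exact congrFun E 0
    · exact (hec (congrFun E 1)).elim
  rcases c2 with E | E
  · exact hec (congrFun E 1).symm
  · exact hec ((congrFun E 0).trans hg.symm)

theorem core {A B : Struct σ} {m n K : ℕ} (hm : 0 < m) (hn : 2 ≤ n)
    (hA : Nat.card A.carrier = n) (hB : Nat.card B.carrier = n) (hK : K + m = n ^ m)
    (bs1 : ∀ s : Fin m → A.carrier, ∃ t : Fin m → B.carrier,
      BF A B (m + 1) K (pad hm s) (pad hm t))
    (bs2 : ∀ t : Fin m → B.carrier, ∃ s : Fin m → A.carrier,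
      BF A B (m + 1) K (pad hm s) (pad hm t)) :
    ∃ f g, ∀ e, BF A B (m + 1) e f g := by
  have : Finite A.carrier := Nat.finite_of_card_ne_zero (by omega)
  have : Finite B.carrier := Nat.finite_of_card_ne_zero (by omega)
  have ntA : Nontrivial A.carrier := Finite.one_lt_card_iff_nontrivial.1 (by omega)
  have ntB : Nontrivial B.carrier := Finite.one_lt_card_iff_nontrivial.1 (by omega)
  have cA : Nat.card (Fin m → A.carrier) = n ^ m := by simp [Nat.card_fun, hA]
  have cB : Nat.card (Fin m → B.carrier) = n ^ m := by simp [Nat.card_fun, hB]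
  obtain ⟨a, a', haa⟩ := ntA
  obtain ⟨b, b', hbb⟩ := ntB
  have hKpos : 0 < K := by
    have h1 : m < 2 ^ m := Nat.lt_two_pow_self
    have h2 : 2 ^ m ≤ n ^ m := Nat.pow_le_pow_left hn m
    omega
  by_cases hst : ∃ d, d < K ∧ ∀ (s : Fin m → A.carrier) (t : Fin m → B.carrier),
      BF A B (m + 1) d (pad hm s) (pad hm t) → BF A B (m + 1) (d + 1) (pad hm s) (pad hm t)
  · obtain ⟨d, hd, H⟩ := hst
    obtain ⟨t, ht⟩ := bs1 (fun _ => a)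
    exact ⟨_, _, fun e => stable_all (stable_step hm H) e _ _ (ht.mono hd.le)⟩
  push Not at hst
  have gA := ncl_growth hm K bs2 hst
  have gB := ncl_growth (A := B) (B := A) hm K (fun t => let ⟨s, hs⟩ := bs1 t; ⟨s, hs.symm⟩)
    (fun d hd => let ⟨s, t, h, h'⟩ := hst d hd; ⟨t, s, h.symm, fun H => h' H.symm⟩)
  have zA := ncl_zero hm a a' haa
  have zB := ncl_zero hm b b' hbb
  have ub : ncl A hm K ≤ n ^ m := by
    rw [← cA]
    exact Nat.card_le_card_of_surjective _ (Quotient.mk_surjective (s := tupS A hm K))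
  have gAK := gA K le_rfl
  have gBK := gB K le_rfl
  have gBK' := gB (K - 1) (by omega)
  obtain ⟨L, rfl⟩ : ∃ L, K = L + 1 := ⟨K - 1, by omega⟩
  simp only [Nat.add_sub_cancel] at gBK'
  have hcA : Nat.card (Fin m → A.carrier) ≤ ncl A hm (L + 1) := by omega
  have hcB : Nat.card (Fin m → B.carrier) ≤ ncl B hm (L + 1) := by omega
  have hcB' : Nat.card (Fin m → B.carrier) ≤ ncl B hm L + 1 := by omega
  have hl := const_total hm bs1
  have hr : ∀ b, ∃ a, BF A B (m + 1) (L + 1) (fun _ => a) (fun _ => b) := fun b =>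
    let ⟨a, ha⟩ := const_total (A := B) (B := A) hm
      (fun t => let ⟨s, hs⟩ := bs2 t; ⟨s, hs.symm⟩) b
    ⟨a, ha.symm⟩
  obtain ⟨b0, hb0⟩ := hl a
  refine ⟨fun _ => a, fun _ => b0, fun e => bf_of_rel
    (fun a b => BF A B (m + 1) (L + 1) (fun _ => a) (fun _ => b)) hl hr ?_ e _ _ fun _ _ => hb0⟩
  intro f g h
  have h3 : m < 3 := by
    by_contra h3
    have := zA.2 (by omega)
    omega
  obtain rfl | rfl : m = 1 ∨ m = 2 := by omega
  · exact atEq_one hm hcA hcB hcB' f g h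
  · exact atEq_two hm hcB hcB' bs1 f g h

end basics

/-- Corollary 6 of the paper. If two `n`-element structures (`n ≥ 2`)
are distinguished by a sentence of `L^k`, then they are distinguished by a sentence `φ`
of `L^k` with `quant φ ≤ (n^(n^(k-1)) - 1)/(n - 1)`. -/
theorem statement_5 (σ : Signature) (k n : ℕ) (hk : 2 ≤ k) (hn : 2 ≤ n)
    (A B : Struct σ) (hA : Nat.card A.carrier = n) (hB : Nat.card B.carrier = n)
    (h : ∃ φ : Fml σ, UsesVars k φ ∧ IsSentence φ ∧ Distinguishes A B φ) :
    ∃ φ : Fml σ, UsesVars k φ ∧ IsSentence φ ∧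
      φ.quant ≤ (n ^ n ^ (k - 1) - 1) / (n - 1) ∧ Distinguishes A B φ := by
  obtain ⟨m, rfl⟩ : ∃ m, k = m + 1 := ⟨k - 1, by omega⟩
  have hm : 0 < m := by omega
  simp only [Nat.add_sub_cancel]
  rw [← qb_eq n hn]
  obtain ⟨K, hK⟩ : ∃ K, K + m = n ^ m := by
    have h1 : m < 2 ^ m := Nat.lt_two_pow_self
    have h2 : 2 ^ m ≤ n ^ m := Nat.pow_le_pow_left hn m
    exact ⟨n ^ m - m, by omega⟩
  rw [← hK]
  have neA : Nonempty A.carrier := (Nat.card_pos_iff.1 (by omega)).1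
  have neB : Nonempty B.carrier := (Nat.card_pos_iff.1 (by omega)).1
  by_cases bs1 : ∀ s : Fin m → A.carrier, ∃ t : Fin m → B.carrier,
      BF A B (m + 1) K (pad hm s) (pad hm t)
  swap
  · push Not at bs1
    obtain ⟨s, hs⟩ := bs1
    obtain ⟨φ, h1, h2, h3, h4, h5⟩ := exists_sentence m n hm hn A B hA hB K s hs
    exact ⟨φ, h1, h2, h3, h4, fun H => h5 (fun _ => neB.some) (H _)⟩
  by_cases bs2 : ∀ t : Fin m → B.carrier, ∃ s : Fin m → A.carrier,
      BF A B (m + 1) K (pad hm s) (pad hm t)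
  swap
  · push Not at bs2
    obtain ⟨t, ht⟩ := bs2
    obtain ⟨φ, h1, h2, h3, h4, h5⟩ := exists_sentence m n hm hn B A hB hA K t
      (fun s hs => ht s hs.symm)
    exact ⟨.not φ, h1, h2, h3, h5, fun H => H (fun _ => neB.some) (h4 _)⟩
  exfalso
  obtain ⟨f, g, hfg⟩ := core hm hn hA hB hK bs1 bs2
  obtain ⟨φ, hu, hs, h1, h2⟩ := h
  apply h2
  intro g'
  have e1 := (BF.sat φ hu 0 f g (hfg _)).1 (h1 f)
  refine (sat_congr B φ g g' ?_).1 e1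
  intro i hi
  rw [hs] at hi
  simp at hi

end QVT
end
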